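/- arXiv:2305.10202 — 2 statements merged into one kernel-verified Lean document; each statement's English description precedes it below -/
import Mathlib

section
/- Let R be a commutative Noetherian ring, 𝔞 an ideal of R, and 𝒮 a Serre subcategory of the category of R-modules. For an R-module M the following are equivalent: (i) Ext^i_R(R/𝔞, M) belongs to 𝒮 for all i ≥ 0; (ii) Tor_i^R(R/𝔞, M) belongs to 𝒮 for all i ≥ 0. -/
universe u

/-- A Serre subcategory of the category of `R`-modules: a class of `R`-modules,
closed under isomorphism, submodules, quotient modules and extensions. -/
structure SerreClass (R : Type u) [CommRing R] : Type (u + 1) where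
  mem : ∀ (M : Type u) [AddCommGroup M] [Module R M], Prop
  mem_of_linearEquiv :
    ∀ (M N : Type u) [AddCommGroup M] [Module R M] [AddCommGroup N] [Module R N],
      (M ≃ₗ[R] N) → mem M → mem N
  mem_submodule :
    ∀ (M : Type u) [AddCommGroup M] [Module R M] (N : Submodule R M), mem M → mem N
  mem_quotient :
    ∀ (M : Type u) [AddCommGroup M] [Module R M] (N : Submodule R M), mem M → mem (M ⧸ N)
  mem_extension :
    ∀ (M : Type u) [AddCommGroup M] [Module R M] (N : Submodule R M),
      mem N → mem (M ⧸ N) → mem M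

open CategoryTheory

/-- The `i`-th Ext module `Ext^i_R(N, M)`. -/
noncomputable def extModule (R : Type u) [CommRing R] (N M : Type u)
    [AddCommGroup N] [Module R N] [AddCommGroup M] [Module R M] (i : ℕ) :
    ModuleCat.{u} R :=
  ((Ext R (ModuleCat.{u} R) i).obj (Opposite.op (ModuleCat.of R N))).obj (ModuleCat.of R M)

/-- The `i`-th Tor module `Tor_i^R(N, M)`. -/
noncomputable def torModule (R : Type u) [CommRing R] (N M : Type u)
    [AddCommGroup N] [Module R N] [AddCommGroup M] [Module R M] (i : ℕ) :
    ModuleCat.{u} R :=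
  ((Tor (ModuleCat.{u} R) i).obj (ModuleCat.of R N)).obj (ModuleCat.of R M)

open Limits

namespace SerreClass

variable {R : Type u} [CommRing R]

/-- The Serre class `𝒮`, seen as a property of objects of `ModuleCat R`. -/
def toObjectProperty (𝒮 : SerreClass R) : ObjectProperty (ModuleCat.{u} R) :=
  fun M => 𝒮.mem M

lemma mem_of_injective (𝒮 : SerreClass R) {M N : Type u} [AddCommGroup M] [Module R M]
    [AddCommGroup N] [Module R N] (f : M →ₗ[R] N) (hf : Function.Injective f)
    (hN : 𝒮.mem N) : 𝒮.mem M :=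
  𝒮.mem_of_linearEquiv _ _ (LinearEquiv.ofInjective f hf).symm (𝒮.mem_submodule N _ hN)

lemma mem_of_surjective (𝒮 : SerreClass R) {M N : Type u} [AddCommGroup M] [Module R M]
    [AddCommGroup N] [Module R N] (f : M →ₗ[R] N) (hf : Function.Surjective f)
    (hM : 𝒮.mem M) : 𝒮.mem N :=
  𝒮.mem_of_linearEquiv _ _ (f.quotKerEquivOfSurjective hf) (𝒮.mem_quotient M _ hM)

lemma isSerreClass (𝒮 : SerreClass R) (h𝒮 : ∃ M, 𝒮.toObjectProperty M) :
    𝒮.toObjectProperty.IsSerreClass where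
  exists_zero := by
    obtain ⟨M, hM⟩ := h𝒮
    exact ⟨ModuleCat.of R PUnit, ModuleCat.isZero_of_subsingleton _,
      𝒮.mem_of_injective (0 : PUnit.{u + 1} →ₗ[R] M) (fun _ _ _ => rfl) hM⟩
  prop_of_mono f _ hY := 𝒮.mem_of_injective f.hom ((ModuleCat.mono_iff_injective f).1 ‹_›) hY
  prop_of_epi f _ hX := 𝒮.mem_of_surjective f.hom ((ModuleCat.epi_iff_surjective f).1 ‹_›) hX
  prop_X₂_of_shortExact {S} hS h₁ h₃ := by
    refine 𝒮.mem_extension S.X₂ (LinearMap.ker S.g.hom) ?_ ?_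
    · have hex := (ShortComplex.moduleCat_exact_iff_range_eq_ker S).1 hS.exact
      rw [← hex]
      exact 𝒮.mem_of_surjective _ S.f.hom.surjective_rangeRestrict h₁
    · exact 𝒮.mem_of_injective (LinearMap.ker S.g.hom |>.liftQ S.g.hom le_rfl)
        (LinearMap.ker_eq_bot.1 (Submodule.ker_liftQ_eq_bot _ _ _ le_rfl)) h₃

end SerreClass

namespace CategoryTheory.ObjectProperty

variable {A : Type*} [Category A] [Abelian A] (P : ObjectProperty A) [P.IsSerreClass]

lemma prop_kernel_of_exact {X Y Z : A} (f : X ⟶ Y) (g : Y ⟶ Z) (w : f ≫ g = 0)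
    (h : (ShortComplex.mk f g w).Exact) (hX : P X) : P (kernel g) := by
  have : Epi (kernel.lift g f w) := h.epi_kernelLift
  exact P.prop_of_epi (kernel.lift g f w) hX

lemma prop_cokernel_of_exact {X Y Z : A} (f : X ⟶ Y) (g : Y ⟶ Z) (w : f ≫ g = 0)
    (h : (ShortComplex.mk f g w).Exact) (hZ : P Z) : P (cokernel f) := by
  have : Mono (cokernel.desc f g w) := h.mono_cokernelDesc
  exact P.prop_of_mono (cokernel.desc f g w) hZ

lemma prop_of_cokernel_of_kernel {X Y Z T W : A} (f : X ⟶ Y) (α : Y ⟶ Z) (δ : Z ⟶ T)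
    (g : T ⟶ W) (w₁ : f ≫ α = 0) (w₂ : α ≫ δ = 0) (w₃ : δ ≫ g = 0)
    (h : (ShortComplex.mk α δ w₂).Exact)
    (hf : P (cokernel f)) (hg : P (kernel g)) : P Z := by
  have w₄ : α ≫ kernel.lift g δ w₃ = 0 := by
    rw [← cancel_mono (kernel.ι g)]; simpa using w₂
  have w₅ : cokernel.desc f α w₁ ≫ kernel.lift g δ w₃ = 0 := by
    rw [← cancel_epi (cokernel.π f)]; simpa using w₄
  have h₁ : (ShortComplex.mk α (kernel.lift g δ w₃) w₄).Exact := by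
    let φ : ShortComplex.mk α (kernel.lift g δ w₃) w₄ ⟶ ShortComplex.mk α δ w₂ :=
      { τ₁ := 𝟙 _, τ₂ := 𝟙 _, τ₃ := kernel.ι g }
    have : Epi φ.τ₁ := inferInstanceAs (Epi (𝟙 _))
    have : IsIso φ.τ₂ := inferInstanceAs (IsIso (𝟙 _))
    have : Mono φ.τ₃ := inferInstanceAs (Mono (kernel.ι g))
    exact (ShortComplex.exact_iff_of_epi_of_isIso_of_mono φ).2 h
  have h₂ : (ShortComplex.mk (cokernel.desc f α w₁) (kernel.lift g δ w₃) w₅).Exact := by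
    let φ : ShortComplex.mk α (kernel.lift g δ w₃) w₄ ⟶
        ShortComplex.mk (cokernel.desc f α w₁) (kernel.lift g δ w₃) w₅ :=
      { τ₁ := cokernel.π f, τ₂ := 𝟙 _, τ₃ := 𝟙 _ }
    have : Epi φ.τ₁ := inferInstanceAs (Epi (cokernel.π f))
    have : IsIso φ.τ₂ := inferInstanceAs (IsIso (𝟙 _))
    have : Mono φ.τ₃ := inferInstanceAs (Mono (𝟙 _))
    exact (ShortComplex.exact_iff_of_epi_of_isIso_of_mono φ).1 h₁
  exact P.prop_X₂_of_exact h₂ hf hg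

/-- If `x` acts nilpotently on `H` and the cokernel of `x` on `H` belongs to a Serre class,
then so does `H`. -/
lemma prop_of_prop_cokernel_smul {R : Type*} [CommRing R] [Linear R A] {H : A} (x : R)
    (h : P (cokernel (x • 𝟙 H))) (m : ℕ) (hm : x ^ m • 𝟙 H = 0) : P H := by
  have key (k : ℕ) : P (cokernel (x ^ k • 𝟙 H)) := by
    induction k with
    | zero =>
      refine P.prop_of_isZero ?_
      rw [pow_zero, one_smul]
      exact isZero_cokernel_of_epi _
    | succ k ih =>
      have w₀ : (x • 𝟙 H) ≫ (x ^ k • cokernel.π (x ^ (k + 1) • 𝟙 H)) = 0 := by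
        have := cokernel.condition (x ^ (k + 1) • 𝟙 H)
        simp only [Linear.smul_comp, Linear.comp_smul, Category.id_comp, smul_smul] at this ⊢
        rwa [← pow_succ]
      let a : cokernel (x • 𝟙 H) ⟶ cokernel (x ^ (k + 1) • 𝟙 H) := cokernel.desc _ _ w₀
      have w₁ : (x ^ (k + 1) • 𝟙 H) ≫ cokernel.π (x ^ k • 𝟙 H) = 0 := by
        have := cokernel.condition (x ^ k • 𝟙 H)
        simp only [Linear.smul_comp, Category.id_comp] at this ⊢
        rw [pow_succ', mul_smul, this, smul_zero]
      have w : a ≫ cokernel.desc _ _ w₁ = 0 := by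
        rw [← cancel_epi (cokernel.π (x • 𝟙 H))]
        have := cokernel.condition (x ^ k • 𝟙 H)
        simp only [Linear.smul_comp, Category.id_comp] at this
        simpa [a] using this
      refine P.prop_X₂_of_exact (S := ShortComplex.mk _ _ w) ?_ h ih
      refine ShortComplex.exact_of_g_is_cokernel _ (CokernelCofork.IsColimit.ofπ' _ _ fun t ht => ?_)
      refine ⟨cokernel.desc _ (cokernel.π (x ^ (k + 1) • 𝟙 H) ≫ t) ?_, ?_⟩
      · have := congrArg (cokernel.π (x • 𝟙 H) ≫ ·) ht
        simpa [a] using this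
      · rw [← cancel_epi (cokernel.π (x ^ (k + 1) • 𝟙 H))]
        simp
  have hk := key m
  rw [hm] at hk
  exact P.prop_of_iso cokernelZeroIsoTarget hk

end CategoryTheory.ObjectProperty

lemma CategoryTheory.ShortComplex.exists_exact_of_iso {C : Type*} [Category C] [HasZeroMorphisms C]
    {X Y Z X' Y' Z' : C} {f : X ⟶ Y} {g : Y ⟶ Z} {w : f ≫ g = 0}
    (h : (ShortComplex.mk f g w).Exact) (a : X ≅ X') (b : Y ≅ Y') (c : Z ≅ Z')
    {f' : X' ⟶ Y'} {g' : Y' ⟶ Z'} (hf : a.hom ≫ f' = f ≫ b.hom) (hg : b.hom ≫ g' = g ≫ c.hom) :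
    ∃ w', (ShortComplex.mk f' g' w').Exact := by
  have w' : f' ≫ g' = 0 := by
    rw [← cancel_epi a.hom, reassoc_of% hf, hg, reassoc_of% w, zero_comp, comp_zero]
  exact ⟨w', ShortComplex.exact_of_iso (ShortComplex.isoMk a b c hf hg) h⟩

namespace CochainComplex

open HomologicalComplex

variable {A : Type*} [Category A] [Abelian A] {R : Type*} [CommRing R] [Linear R A]

/-- The mapping cone of multiplication by `x` on a cochain complex. -/
noncomputable abbrev smulCone (x : R) (K : CochainComplex A ℤ) : CochainComplex A ℤ :=
  mappingCone (x • 𝟙 K)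

lemma homologyMap_smul_id (x : R) (K : CochainComplex A ℤ) (i : ℤ) :
    homologyMap (x • 𝟙 K) i = x • 𝟙 (K.homology i) := by
  have := ShortComplex.homologyMap_smul (𝟙 (K.sc i)) x
  rw [ShortComplex.homologyMap_id] at this
  exact this

/-- The long exact homology sequence of the mapping cone of multiplication by `x`. -/
lemma exists_smulCone_exact (x : R) (K : CochainComplex A ℤ) (i : ℤ) :
    ∃ (α : K.homology i ⟶ (smulCone x K).homology i)
      (δ : (smulCone x K).homology i ⟶ K.homology (i + 1)),
      (∃ w, (ShortComplex.mk (x • 𝟙 (K.homology i)) α w).Exact) ∧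
        (∃ w, (ShortComplex.mk α δ w).Exact) ∧
          ∃ w, (ShortComplex.mk δ (x • 𝟙 (K.homology (i + 1))) w).Exact := by
  let := HasDerivedCategory.standard A
  let T := DerivedCategory.Q.mapTriangle.obj (mappingCone.triangle (x • 𝟙 K))
  have hT : T ∈ Pretriangulated.distinguishedTriangles :=
    DerivedCategory.mappingCone_triangle_distinguished _
  let e (L : CochainComplex A ℤ) (j : ℤ) := (DerivedCategory.homologyFunctorFactors A j).app L
  let α : K.homology i ⟶ (smulCone x K).homology i := homologyMap (mappingCone.inr _) i
  let δ : (smulCone x K).homology i ⟶ K.homology (i + 1) :=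
    (e (smulCone x K) i).inv ≫ DerivedCategory.HomologySequence.δ T i (i + 1) ≫ (e K (i + 1)).hom
  have c₁ (j : ℤ) : (e K j).hom ≫ (x • 𝟙 (K.homology j)) =
      (DerivedCategory.homologyFunctor A j).map T.mor₁ ≫ (e K j).hom := by
    rw [← homologyMap_smul_id]
    exact (DerivedCategory.homologyFunctorFactors_hom_naturality _ _).symm
  have c₂ : (e K i).hom ≫ α =
      (DerivedCategory.homologyFunctor A i).map T.mor₂ ≫ (e (smulCone x K) i).hom :=
    (DerivedCategory.homologyFunctorFactors_hom_naturality _ _).symm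
  have c₃ : (e (smulCone x K) i).hom ≫ δ =
      DerivedCategory.HomologySequence.δ T i (i + 1) ≫ (e K (i + 1)).hom :=
    Iso.hom_inv_id_assoc _ _
  exact ⟨α, δ,
    ShortComplex.exists_exact_of_iso (DerivedCategory.HomologySequence.exact₂ T hT i)
      (e K i) (e K i) (e (smulCone x K) i) (c₁ i) c₂,
    ShortComplex.exists_exact_of_iso (DerivedCategory.HomologySequence.exact₃ T hT i (i + 1))
      (e K i) (e (smulCone x K) i) (e K (i + 1)) c₂ c₃,
    ShortComplex.exists_exact_of_iso (DerivedCategory.HomologySequence.exact₁ T hT i (i + 1))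
      (e (smulCone x K) i) (e K (i + 1)) (e K (i + 1)) c₃ (c₁ (i + 1))⟩

/-- Complexes that become isomorphic in the derived category. -/
def IsDerivedEquiv (K L : CochainComplex A ℤ) : Prop :=
  letI := HasDerivedCategory.standard A
  Nonempty ((DerivedCategory.Q (C := A)).obj K ≅ DerivedCategory.Q.obj L)

lemma IsDerivedEquiv.of_quasiIso {K L : CochainComplex A ℤ} (f : K ⟶ L) [QuasiIso f] :
    IsDerivedEquiv K L :=
  let := HasDerivedCategory.standard A
  ⟨asIso (DerivedCategory.Q.map f)⟩

lemma IsDerivedEquiv.symm {K L : CochainComplex A ℤ} (h : IsDerivedEquiv K L) :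
    IsDerivedEquiv L K :=
  let := HasDerivedCategory.standard A
  h.map Iso.symm

lemma IsDerivedEquiv.trans {K L M : CochainComplex A ℤ} (h : IsDerivedEquiv K L)
    (h' : IsDerivedEquiv L M) : IsDerivedEquiv K M :=
  let := HasDerivedCategory.standard A
  h.elim fun e => h'.map fun e' => e ≪≫ e'

lemma IsDerivedEquiv.nonempty_homology_iso {K L : CochainComplex A ℤ} (h : IsDerivedEquiv K L)
    (i : ℤ) : Nonempty (K.homology i ≅ L.homology i) :=
  let := HasDerivedCategory.standard A
  h.map fun e => ((DerivedCategory.homologyFunctorFactors A i).app K).symm ≪≫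
    (DerivedCategory.homologyFunctor A i).mapIso e ≪≫
      (DerivedCategory.homologyFunctorFactors A i).app L

lemma IsDerivedEquiv.smulCone {K L : CochainComplex A ℤ} (h : IsDerivedEquiv K L) (x : R) :
    IsDerivedEquiv (smulCone x K) (smulCone x L) := by
  let := HasDerivedCategory.standard A
  obtain ⟨e⟩ := h
  let T (K : CochainComplex A ℤ) := DerivedCategory.Q.mapTriangle.obj (mappingCone.triangle (x • 𝟙 K))
  have hT (K : CochainComplex A ℤ) : T K ∈ Pretriangulated.distinguishedTriangles :=
    DerivedCategory.mappingCone_triangle_distinguished _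
  refine ⟨Pretriangulated.Triangle.π₃.mapIso
    (Pretriangulated.isoTriangleOfIso₁₂ (T K) (T L) (hT K) (hT L) e e ?_)⟩
  change DerivedCategory.Q.map (x • 𝟙 K) ≫ e.hom = e.hom ≫ DerivedCategory.Q.map (x • 𝟙 L)
  simp [Functor.map_smul]

end CochainComplex

namespace CochainComplex

variable {A : Type*} [Category A] [Abelian A] {R : Type*} [CommRing R] [Linear R A]

/-- The Koszul complex on a list of elements with coefficients in a cochain complex, as an iterated
mapping cone. -/
noncomputable def koszul : List R → CochainComplex A ℤ → CochainComplex A ℤ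
  | [], X => X
  | x :: xs, X => koszul xs (smulCone x X)

lemma IsDerivedEquiv.koszul {K L : CochainComplex A ℤ} (h : IsDerivedEquiv K L) (xs : List R) :
    IsDerivedEquiv (koszul xs K) (koszul xs L) := by
  induction xs generalizing K L with
  | nil => exact h
  | cons x xs ih => exact ih (h.smulCone x)

end CochainComplex

open CochainComplex

section KoszulTheory

variable {R : Type u} [CommRing R]

/-- A family of vanishing-type conditions `h N X i` on modules `N`, complexes `X` in a class `𝒳`,
and degrees `i`, that behaves like the membership in a Serre class of the modules
`H^i(Hom(N, X))` for bounded below complexes `X` of injective modules, or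
`H_i(N ⊗ X)` for bounded above complexes `X` of flat modules. -/
structure IsKoszulTheory (𝒳 : CochainComplex (ModuleCat.{u} R) ℤ → Prop)
    (h : ModuleCat.{u} R → CochainComplex (ModuleCat.{u} R) ℤ → ℤ → Prop) : Prop where
  smulCone_mem {X} (hX : 𝒳 X) (x : R) : 𝒳 (smulCone x X)
  of_subsingleton {X} (hX : 𝒳 X) (N : ModuleCat.{u} R) [Subsingleton N] (i : ℤ) : h N X i
  bounded {X} (hX : 𝒳 X) : ∃ b : ℤ, ∀ N, ∀ i < b, h N X i
  middle {X} (hX : 𝒳 X) {N₁ N₂ N₃ : ModuleCat.{u} R} (f : N₁ →ₗ[R] N₂) (g : N₂ →ₗ[R] N₃)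
    (hf : Function.Injective f) (hfg : Function.Exact f g) (hg : Function.Surjective g) (i : ℤ)
    (h₁ : h N₁ X i) (h₃ : h N₃ X i) : h N₂ X i
  right {X} (hX : 𝒳 X) {N₁ N₂ N₃ : ModuleCat.{u} R} (f : N₁ →ₗ[R] N₂) (g : N₂ →ₗ[R] N₃)
    (hf : Function.Injective f) (hfg : Function.Exact f g) (hg : Function.Surjective g) (i : ℤ)
    (h₂ : h N₂ X i) (h₁ : h N₁ X (i - 1)) : h N₃ X i
  smulCone {X} (hX : 𝒳 X) (N : ModuleCat.{u} R) (x : R) (hN : ∀ i, h N X i) (i : ℤ) :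
    h N (smulCone x X) i
  of_smulCone {X} (hX : 𝒳 X) (N : ModuleCat.{u} R) (x : R) (m : ℕ) (hm : ∀ n : N, x ^ m • n = 0)
    (hN : ∀ i, h N (CochainComplex.smulCone x X) i) (i : ℤ) : h N X i
  smulCone_of_quotient {X} (hX : 𝒳 X) {N N' : ModuleCat.{u} R} (x : R) (g : N →ₗ[R] N')
    (hx : Function.Injective (fun n : N => x • n)) (hxg : Function.Exact (fun n : N => x • n) g)
    (hg : Function.Surjective g) (hN' : ∀ i, h N' X i) (i : ℤ) :
    h N (CochainComplex.smulCone x X) i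

/-- Every element of `xs` acts nilpotently on `N`. -/
def IsNilpotentOn (xs : List R) (N : Type*) [AddCommGroup N] [Module R N] : Prop :=
  ∀ x ∈ xs, ∃ m : ℕ, ∀ n : N, x ^ m • n = 0

lemma IsNilpotentOn.of_injective {xs : List R} {N N' : Type*} [AddCommGroup N] [Module R N]
    [AddCommGroup N'] [Module R N'] (h : IsNilpotentOn xs N) (f : N' →ₗ[R] N)
    (hf : Function.Injective f) : IsNilpotentOn xs N' := fun x hx =>
  (h x hx).imp fun m hm n => hf (by rw [map_smul, hm, map_zero])

lemma IsNilpotentOn.of_surjective {xs : List R} {N N' : Type*} [AddCommGroup N] [Module R N]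
    [AddCommGroup N'] [Module R N'] (h : IsNilpotentOn xs N) (f : N →ₗ[R] N')
    (hf : Function.Surjective f) : IsNilpotentOn xs N' := fun x hx =>
  (h x hx).imp fun m hm n => by
    obtain ⟨n, rfl⟩ := hf n
    rw [← map_smul, hm, map_zero]

namespace IsKoszulTheory

variable {𝒳 : CochainComplex (ModuleCat.{u} R) ℤ → Prop}
  {h : ModuleCat.{u} R → CochainComplex (ModuleCat.{u} R) ℤ → ℤ → Prop}
  (H : IsKoszulTheory 𝒳 h) {X : CochainComplex (ModuleCat.{u} R) ℤ} (hX : 𝒳 X)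

include H hX

lemma of_submodule {N : Type u} [AddCommGroup N] [Module R N] (K : Submodule R N) (i : ℤ)
    (h₁ : h (.of R K) X i) (h₃ : h (.of R (N ⧸ K)) X i) : h (.of R N) X i :=
  H.middle hX (N₁ := .of R K) (N₂ := .of R N) (N₃ := .of R (N ⧸ K)) K.subtype K.mkQ
    K.subtype_injective (LinearMap.exact_subtype_mkQ K) K.mkQ_surjective i h₁ h₃

lemma of_fin_fun {N : Type u} [AddCommGroup N] [Module R N] (i : ℤ) (hN : h (.of R N) X i)
    (r : ℕ) : h (.of R (Fin r → N)) X i := by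
  induction r with
  | zero => exact H.of_subsingleton hX (.of R (Fin 0 → N)) i
  | succ r ih =>
    have hex : Function.Exact (LinearMap.single R (fun _ : Fin (r + 1) => N) 0)
        (LinearMap.funLeft R N Fin.succ) := by
      refine fun v => ⟨fun hv => ⟨v 0, ?_⟩, ?_⟩
      · ext j
        refine Fin.cases (by simp) (fun j => ?_) j
        have := congrFun hv j
        rw [LinearMap.funLeft_apply, Pi.zero_apply] at this
        simp [this]
      · rintro ⟨n, rfl⟩
        ext j
        simp
    exact H.middle hX (N₁ := .of R N) (N₂ := .of R (Fin (r + 1) → N)) (N₃ := .of R (Fin r → N))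
      _ _ (Pi.single_injective (M := fun _ : Fin (r + 1) => N) 0) hex
      (LinearMap.funLeft_surjective_of_injective _ _ _ (Fin.succ_injective r)) i hN ih

/-- Dimension shifting: the conditions for `R ⧸ I` imply those for every finite module killed
by `I`. -/
lemma of_finite_of_smul_eq_zero [IsNoetherianRing R] (I : Ideal R)
    (hI : ∀ i, h (.of R (R ⧸ I)) X i) (N : Type u) [AddCommGroup N] [Module R N]
    [Module.Finite R N] (hN : ∀ r ∈ I, ∀ n : N, r • n = 0) (i : ℤ) : h (.of R N) X i := by
  obtain ⟨b, hb⟩ := H.bounded hX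
  have key (k : ℕ) : ∀ (N : Type u) [AddCommGroup N] [Module R N] [Module.Finite R N],
      (∀ r ∈ I, ∀ n : N, r • n = 0) → ∀ i < b + k, h (.of R N) X i := by
    induction k with
    | zero => intro N _ _ _ _ i hi; exact hb _ _ (by simpa using hi)
    | succ k ih =>
      intro N _ _ _ hN i hi
      obtain ⟨r, v, hv⟩ := Module.Finite.exists_fin (R := R) (M := N)
      let p (j : Fin r) : (R ⧸ I) →ₗ[R] N :=
        Submodule.liftQ I (LinearMap.toSpanSingleton R N (v j)) fun a ha => hN a ha _
      let q : (Fin r → R ⧸ I) →ₗ[R] N := LinearMap.lsum R (fun _ => R ⧸ I) R p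
      have hq : Function.Surjective q := by
        rw [← LinearMap.range_eq_top, eq_top_iff, ← hv, Submodule.span_le]
        rintro _ ⟨j, rfl⟩
        refine ⟨Pi.single j (Submodule.Quotient.mk 1), ?_⟩
        simp only [q, LinearMap.lsum_piSingle]
        exact one_smul R (v j)
      refine H.right hX (N₁ := .of R (LinearMap.ker q)) (N₂ := .of R (Fin r → R ⧸ I))
        (N₃ := .of R N) (LinearMap.ker q).subtype q (Submodule.subtype_injective _)
        (LinearMap.exact_subtype_ker_map q) hq i (H.of_fin_fun hX i (hI i) r)
        (ih _ (fun a ha n => Subtype.ext (funext fun j => ?_)) _ (by push_cast at hi; lia))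
      obtain ⟨c, hc⟩ := Submodule.Quotient.mk_surjective _ ((n : Fin r → R ⧸ I) j)
      change a • (n : Fin r → R ⧸ I) j = 0
      rw [← hc, ← Submodule.Quotient.mk_smul, Submodule.Quotient.mk_eq_zero]
      exact I.mul_mem_right _ ha
  exact key (i - b + 1).toNat N hN i (by lia)

/-- The conditions for all finite modules on which the elements of `xs` act nilpotently are
detected by the Koszul complex on `xs`. -/
lemma forall_isNilpotentOn_iff [IsNoetherianRing R] (xs : List R) :
    (∀ (N : Type u) [AddCommGroup N] [Module R N] [Module.Finite R N], IsNilpotentOn xs N →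
      ∀ i, h (.of R N) X i) ↔ ∀ i, h (.of R R) (koszul xs X) i := by
  induction xs generalizing X with
  | nil =>
    refine ⟨fun hN => hN R (by simp [IsNilpotentOn]), fun hR N _ _ _ _ => ?_⟩
    refine H.of_finite_of_smul_eq_zero hX ⊥ (fun i => ?_) N (by simp)
    have e := Submodule.quotEquivOfEqBot (⊥ : Ideal R) rfl
    exact H.middle hX (N₁ := .of R R) (N₂ := .of R (R ⧸ (⊥ : Ideal R))) (N₃ := .of R PUnit)
      e.symm.toLinearMap 0 e.symm.injective (fun y => by simp)
      (fun _ => ⟨0, rfl⟩) i (hR i) (H.of_subsingleton hX (.of R PUnit) i)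
  | cons x xs ih =>
    rw [koszul, ← ih (H.smulCone_mem hX x)]
    refine ⟨fun hN N _ _ _ hxs => ?_, fun hN N _ _ _ hxs i => ?_⟩
    · obtain ⟨m, hm⟩ := monotone_stabilizes_iff_noetherian.2 (inferInstance : IsNoetherian R N)
        ⟨fun k => LinearMap.ker (x ^ k • LinearMap.id : N →ₗ[R] N), fun k l hkl n hn => by
          obtain ⟨c, rfl⟩ := Nat.exists_eq_add_of_le hkl
          simp only [LinearMap.mem_ker, LinearMap.smul_apply, LinearMap.id_apply] at hn ⊢
          rw [add_comm, pow_add, mul_smul, hn, smul_zero]⟩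
      set Γ := LinearMap.ker (x ^ m • LinearMap.id : N →ₗ[R] N) with hΓ
      have memΓ (n : N) : n ∈ Γ ↔ x ^ m • n = 0 := by simp [hΓ]
      have hΓx (n : N) (hn : x • n ∈ Γ) : n ∈ Γ := by
        have : n ∈ LinearMap.ker (x ^ (m + 1) • LinearMap.id : N →ₗ[R] N) := by
          simpa [pow_succ, mul_smul] using (memΓ _).1 hn
        exact (hm (m + 1) (Nat.le_succ m)).ge this
      refine fun i => H.of_submodule (H.smulCone_mem hX x) Γ i ?_ ?_
      · refine H.smulCone hX (.of R Γ) x (hN Γ ?_) i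
        refine List.forall_mem_cons.2 ⟨⟨m, fun n => Subtype.ext ?_⟩,
          hxs.of_injective Γ.subtype Γ.subtype_injective⟩
        simpa using (memΓ _).1 n.2
      · let q := LinearMap.range (x • LinearMap.id : (N ⧸ Γ) →ₗ[R] (N ⧸ Γ))
        refine H.smulCone_of_quotient hX (N := .of R (N ⧸ Γ)) (N' := .of R ((N ⧸ Γ) ⧸ q)) x q.mkQ
          ?_ (fun n => by simp [q]) q.mkQ_surjective (hN ((N ⧸ Γ) ⧸ q) ?_) i
        · refine (injective_iff_map_eq_zero (x • LinearMap.id : (N ⧸ Γ) →ₗ[R] (N ⧸ Γ))).2 ?_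
          intro n hn
          obtain ⟨n, rfl⟩ := Submodule.Quotient.mk_surjective _ n
          rw [LinearMap.smul_apply, LinearMap.id_apply, ← Submodule.Quotient.mk_smul,
            Submodule.Quotient.mk_eq_zero] at hn
          rw [Submodule.Quotient.mk_eq_zero]
          exact hΓx _ hn
        · refine List.forall_mem_cons.2 ⟨⟨1, fun n => ?_⟩,
            (hxs.of_surjective Γ.mkQ Γ.mkQ_surjective).of_surjective q.mkQ q.mkQ_surjective⟩
          obtain ⟨n, rfl⟩ := Submodule.Quotient.mk_surjective _ n
          rw [pow_one, ← Submodule.Quotient.mk_smul, Submodule.Quotient.mk_eq_zero]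
          exact ⟨n, rfl⟩
    · obtain ⟨⟨m, hm⟩, hxs'⟩ := List.forall_mem_cons.1 hxs
      exact H.of_smulCone hX (.of R N) x m hm (hN N hxs') i

lemma quotient_iff_forall_isNilpotentOn [IsNoetherianRing R] (xs : List R) :
    (∀ i, h (.of R (R ⧸ Ideal.ofList xs)) X i) ↔
      ∀ (N : Type u) [AddCommGroup N] [Module R N] [Module.Finite R N], IsNilpotentOn xs N →
        ∀ i, h (.of R N) X i := by
  set I := Ideal.ofList xs with hI
  have hxI (x) (hx : x ∈ xs) : x ∈ I := Ideal.subset_span hx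
  refine ⟨fun hR N _ _ _ hN => ?_, fun hN => hN _ fun x hx => ⟨1, fun n => ?_⟩⟩
  · have hle : I ≤ (Module.annihilator R N).radical := by
      refine Ideal.span_le.2 fun x hx => ?_
      obtain ⟨m, hm⟩ := hN x hx
      exact ⟨m, Module.mem_annihilator.2 hm⟩
    obtain ⟨k, hk⟩ := Ideal.exists_pow_le_of_le_radical_of_fg hle (IsNoetherian.noetherian I)
    have key (k : ℕ) : ∀ (N : Type u) [AddCommGroup N] [Module R N] [Module.Finite R N],
        (∀ r ∈ I ^ k, ∀ n : N, r • n = 0) → ∀ i, h (.of R N) X i := by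
      induction k with
      | zero =>
        intro N _ _ _ hk
        have : Subsingleton N := ⟨fun a b => by
          have h1 := hk 1 (by simp)
          rw [← one_smul R a, ← one_smul R b, h1, h1]⟩
        exact fun i => H.of_subsingleton hX (.of R N) i
      | succ k ih =>
        intro N _ _ _ hk
        refine fun i => H.of_submodule hX (I • (⊤ : Submodule R N)) i (ih _ (fun r hr n => ?_) i)
          (H.of_finite_of_smul_eq_zero hX I hR _ (fun r hr n => ?_) i)
        · obtain ⟨n, hn⟩ := n
          refine Subtype.ext ?_
          change r • n = 0
          induction hn using Submodule.smul_induction_on' with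
          | smul a ha n _ => rw [← mul_smul]; exact hk _ (pow_succ I k ▸ Ideal.mul_mem_mul hr ha) n
          | add a _ b _ iha ihb => rw [smul_add, iha, ihb, add_zero]
        · obtain ⟨n, rfl⟩ := Submodule.Quotient.mk_surjective _ n
          rw [← Submodule.Quotient.mk_smul, Submodule.Quotient.mk_eq_zero]
          exact Submodule.smul_mem_smul hr trivial
    exact key k N fun r hr n => Module.mem_annihilator.1 (hk hr) n
  · obtain ⟨n, rfl⟩ := Submodule.Quotient.mk_surjective _ n
    rw [pow_one, ← Submodule.Quotient.mk_smul, Submodule.Quotient.mk_eq_zero]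
    exact I.mul_mem_right _ (hxI x hx)

/-- The conditions for `R ⧸ (xs)` are detected by the Koszul complex on `xs`. -/
theorem quotient_iff_koszul [IsNoetherianRing R] (xs : List R) :
    (∀ i, h (.of R (R ⧸ Ideal.ofList xs)) X i) ↔ ∀ i, h (.of R R) (koszul xs X) i :=
  (H.quotient_iff_forall_isNilpotentOn hX xs).trans (H.forall_isNilpotentOn_iff hX xs)

end IsKoszulTheory

end KoszulTheory

section SerreCone

open HomologicalComplex

variable {A : Type*} [Category A] [Abelian A] {R : Type*} [CommRing R] [Linear R A]
  (P : ObjectProperty A) [P.IsSerreClass] {K L : CochainComplex A ℤ} (x : R)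

lemma prop_homology_smulCone (hK : ∀ i, P (K.homology i)) (i : ℤ) :
    P ((smulCone x K).homology i) := by
  obtain ⟨α, δ, -, ⟨w, h⟩, -⟩ := exists_smulCone_exact x K i
  exact P.prop_X₂_of_exact h (hK i) (hK (i + 1))

lemma prop_homology_of_smulCone (m : ℕ) (hm : x ^ m • 𝟙 K = 0)
    (hK : ∀ i, P ((smulCone x K).homology i)) (i : ℤ) : P (K.homology i) := by
  obtain ⟨α, δ, ⟨w, h⟩, -, -⟩ := exists_smulCone_exact x K i
  refine P.prop_of_prop_cokernel_smul x (P.prop_cokernel_of_exact _ _ w h (hK i)) m ?_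
  rw [← homologyMap_smul_id, hm, homologyMap_zero]

lemma prop_homology_smulCone_of_shortExact_left (g : K ⟶ L) (w : (x • 𝟙 K) ≫ g = 0)
    (h : (ShortComplex.mk _ _ w).ShortExact) (hL : ∀ i, P (L.homology i)) (i : ℤ) :
    P ((smulCone x K).homology i) := by
  obtain ⟨α, δ, ⟨w₁, -⟩, ⟨w₂, h₂⟩, ⟨w₃, -⟩⟩ := exists_smulCone_exact x K i
  refine P.prop_of_cokernel_of_kernel _ _ _ _ w₁ w₂ w₃ h₂ ?_ ?_
  · rw [← homologyMap_smul_id]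
    exact P.prop_cokernel_of_exact _ _ _ (h.homology_exact₂ i) (hL i)
  · rw [← homologyMap_smul_id]
    exact P.prop_kernel_of_exact _ _ _ (h.homology_exact₁ i (i + 1) rfl) (hL i)

lemma prop_homology_smulCone_of_shortExact_right (f : L ⟶ K) (w : f ≫ (x • 𝟙 K) = 0)
    (h : (ShortComplex.mk _ _ w).ShortExact) (hL : ∀ i, P (L.homology i)) (i : ℤ) :
    P ((smulCone x K).homology i) := by
  obtain ⟨α, δ, ⟨w₁, -⟩, ⟨w₂, h₂⟩, ⟨w₃, -⟩⟩ := exists_smulCone_exact x K i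
  refine P.prop_of_cokernel_of_kernel _ _ _ _ w₁ w₂ w₃ h₂ ?_ ?_
  · rw [← homologyMap_smul_id]
    exact P.prop_cokernel_of_exact _ _ _ (h.homology_exact₃ i (i + 1) rfl) (hL (i + 1))
  · rw [← homologyMap_smul_id]
    exact P.prop_kernel_of_exact _ _ _ (h.homology_exact₂ (i + 1)) (hL (i + 1))

/-- Linear functors commute with mapping cones of multiplication maps. -/
noncomputable def mapSmulConeIso (F : A ⥤ A) [F.Additive] [F.Linear R] (x : R)
    (K : CochainComplex A ℤ) :
    (F.mapHomologicalComplex _).obj (smulCone x K) ≅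
      smulCone x ((F.mapHomologicalComplex _).obj K) :=
  mappingCone.mapHomologicalComplexIso (x • 𝟙 K) F ≪≫
    eqToIso (by simp only [Functor.map_smul, CategoryTheory.Functor.map_id])

lemma isZero_homology_map (F : A ⥤ A) [F.Additive] (i : ℤ) (hK : IsZero (K.X i)) :
    IsZero (((F.mapHomologicalComplex (ComplexShape.up ℤ)).obj K).homology i) :=
  ShortComplex.isZero_homology_of_isZero_X₂ _ (F.map_isZero hK)

end SerreCone

section HomTensor

open HomologicalComplex MonoidalCategory

variable {R : Type u} [CommRing R]

instance linearCoyoneda_obj_linear (N : (ModuleCat.{u} R)ᵒᵖ) :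
    ((linearCoyoneda R (ModuleCat.{u} R)).obj N).Linear R where
  map_smul f r := by
    ext g
    exact Linear.comp_smul (R := R) _ _ _ g r f

/-- The complex `Hom(N, X)`. -/
noncomputable abbrev homComplex (N : ModuleCat.{u} R) (X : CochainComplex (ModuleCat.{u} R) ℤ) :
    CochainComplex (ModuleCat.{u} R) ℤ :=
  (((linearCoyoneda R (ModuleCat.{u} R)).obj (.op N)).mapHomologicalComplex _).obj X

/-- The complex `N ⊗ X`. -/
noncomputable abbrev tensorComplex (N : ModuleCat.{u} R)
    (X : CochainComplex (ModuleCat.{u} R) ℤ) : CochainComplex (ModuleCat.{u} R) ℤ :=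
  (((tensoringLeft (ModuleCat.{u} R)).obj N).mapHomologicalComplex _).obj X

/-- The functoriality of `homComplex N X` in `N`. -/
noncomputable abbrev homComplexMap {N N' : ModuleCat.{u} R} (f : N ⟶ N')
    (X : CochainComplex (ModuleCat.{u} R) ℤ) : homComplex N' X ⟶ homComplex N X :=
  (NatTrans.mapHomologicalComplex ((linearCoyoneda R (ModuleCat.{u} R)).map f.op) _).app X

/-- The functoriality of `tensorComplex N X` in `N`. -/
noncomputable abbrev tensorComplexMap {N N' : ModuleCat.{u} R} (f : N ⟶ N')
    (X : CochainComplex (ModuleCat.{u} R) ℤ) : tensorComplex N X ⟶ tensorComplex N' X :=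
  (NatTrans.mapHomologicalComplex ((tensoringLeft (ModuleCat.{u} R)).map f) _).app X

variable {N N₁ N₂ N₃ : ModuleCat.{u} R} (X : CochainComplex (ModuleCat.{u} R) ℤ)

lemma exists_homComplex_shortExact [∀ i, Injective (X.X i)] (f : N₁ ⟶ N₂) (g : N₂ ⟶ N₃)
    (hf : Function.Injective f) (hfg : Function.Exact f g) (hg : Function.Surjective g) :
    ∃ w, (ShortComplex.mk (homComplexMap g X) (homComplexMap f X) w).ShortExact := by
  have w₀ : f ≫ g = 0 := by ext n; exact hfg.apply_apply_eq_zero n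
  have : Mono f := (ModuleCat.mono_iff_injective f).2 hf
  have : Epi g := (ModuleCat.epi_iff_surjective g).2 hg
  have hex : (ShortComplex.mk f g w₀).Exact :=
    (ShortComplex.ShortExact.moduleCat_exact_iff_function_exact _).2 hfg
  have w : homComplexMap g X ≫ homComplexMap f X = 0 := by
    ext i (a : N₃ ⟶ X.X i)
    change f ≫ g ≫ a = 0
    rw [reassoc_of% w₀, zero_comp]
  refine ⟨w, HomologicalComplex.shortExact_of_degreewise_shortExact _ fun i => ?_⟩
  refine { exact := ?_, mono_f := ?_, epi_g := ?_ }
  · refine (ShortComplex.moduleCat_exact_iff _).2 fun (a : N₂ ⟶ X.X i) (ha : f ≫ a = 0) => ?_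
    exact ⟨hex.desc a ha, hex.g_desc a ha⟩
  · refine (ModuleCat.mono_iff_injective _).2 fun (a b : N₃ ⟶ X.X i) (hab : g ≫ a = g ≫ b) => ?_
    exact (cancel_epi g).1 hab
  · refine (ModuleCat.epi_iff_surjective _).2 fun (a : N₁ ⟶ X.X i) => ?_
    exact ⟨Injective.factorThru a f, Injective.comp_factorThru a f⟩

lemma exists_tensorComplex_shortExact [∀ i, Projective (X.X i)] (f : N₁ ⟶ N₂) (g : N₂ ⟶ N₃)
    (hf : Function.Injective f) (hfg : Function.Exact f g) (hg : Function.Surjective g) :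
    ∃ w, (ShortComplex.mk (tensorComplexMap f X) (tensorComplexMap g X) w).ShortExact := by
  have hex (i : ℤ) : Function.Exact (f.hom.rTensor (X.X i)) (g.hom.rTensor (X.X i)) :=
    rTensor_exact _ hfg hg
  have w : tensorComplexMap f X ≫ tensorComplexMap g X = 0 := by
    ext i : 2
    exact LinearMap.ext fun a => (hex i).apply_apply_eq_zero a
  refine ⟨w, HomologicalComplex.shortExact_of_degreewise_shortExact _ fun i => ?_⟩
  have : Module.Projective R (X.X i) := (IsProjective.iff_projective _).2 inferInstance
  refine { exact := ?_, mono_f := ?_, epi_g := ?_ }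
  · exact (ShortComplex.ShortExact.moduleCat_exact_iff_function_exact _).2 (hex i)
  · exact (ModuleCat.mono_iff_injective _).2
      (Module.Flat.rTensor_preserves_injective_linearMap f.hom hf)
  · exact (ModuleCat.epi_iff_surjective _).2 (LinearMap.rTensor_surjective _ hg)

lemma homComplexMap_smul (x : R) : homComplexMap (x • 𝟙 N) X = x • 𝟙 (homComplex N X) := by
  ext i (a : N ⟶ X.X i)
  exact (Linear.smul_comp _ _ _ _ _ _).trans (congrArg (x • ·) (Category.id_comp a))

lemma tensorComplexMap_smul (x : R) :
    tensorComplexMap (x • 𝟙 N) X = x • 𝟙 (tensorComplex N X) := by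
  ext i : 2
  exact (LinearMap.rTensor_smul (X.X i) x LinearMap.id).trans
    (congrArg (x • ·) (LinearMap.rTensor_id _ _))

end HomTensor

section Instances

variable {R : Type u} [CommRing R]

/-- Multiplication by `x` on the mapping cone, in each degree, is a biproduct. -/
noncomputable def smulConeXIso {A : Type*} [Category A] [Abelian A] [Linear R A] (x : R)
    (X : CochainComplex A ℤ) (i : ℤ) : (smulCone x X).X i ≅ X.X (i + 1) ⊞ X.X i :=
  HomologicalComplex.homotopyCofiber.XIsoBiprod (x • 𝟙 X) i (i + 1) rfl

/-- Bounded below complexes of injective modules. -/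
def IsInjectivePlus (X : CochainComplex (ModuleCat.{u} R) ℤ) : Prop :=
  (∀ i, Injective (X.X i)) ∧ ∃ b : ℤ, ∀ i < b, IsZero (X.X i)

/-- Bounded above complexes of projective modules. -/
def IsProjectiveMinus (X : CochainComplex (ModuleCat.{u} R) ℤ) : Prop :=
  (∀ i, Projective (X.X i)) ∧ ∃ b : ℤ, ∀ i > b, IsZero (X.X i)

lemma IsInjectivePlus.smulCone {X : CochainComplex (ModuleCat.{u} R) ℤ} (hX : IsInjectivePlus X)
    (x : R) : IsInjectivePlus (smulCone x X) := by
  obtain ⟨h, b, hb⟩ := hX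
  refine ⟨fun i => Injective.of_iso (smulConeXIso x X i).symm inferInstance, b - 1, fun i hi => ?_⟩
  exact ((biprod_isZero_iff _ _).2 ⟨hb _ (by lia), hb _ (by lia)⟩).of_iso (smulConeXIso x X i)

lemma IsProjectiveMinus.smulCone {X : CochainComplex (ModuleCat.{u} R) ℤ}
    (hX : IsProjectiveMinus X) (x : R) : IsProjectiveMinus (smulCone x X) := by
  obtain ⟨h, b, hb⟩ := hX
  refine ⟨fun i => Projective.of_iso (smulConeXIso x X i).symm inferInstance, b, fun i hi => ?_⟩
  exact ((biprod_isZero_iff _ _).2 ⟨hb _ (by lia), hb _ (by lia)⟩).of_iso (smulConeXIso x X i)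

variable (P : ObjectProperty (ModuleCat.{u} R)) [P.IsSerreClass]

lemma isKoszulTheory_hom :
    IsKoszulTheory (R := R) IsInjectivePlus fun N X i => P ((homComplex N X).homology i) where
  smulCone_mem hX x := hX.smulCone x
  of_subsingleton {X} _ N _ i := by
    refine P.prop_of_isZero (ShortComplex.isZero_homology_of_isZero_X₂ _ ?_)
    have hN : IsZero N := ModuleCat.isZero_of_subsingleton N
    exact @ModuleCat.isZero_of_subsingleton _ _ _ ⟨fun (a b : N ⟶ X.X i) => hN.eq_of_src a b⟩
  bounded hX := hX.2.imp fun b hb N i hi =>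
    P.prop_of_isZero (isZero_homology_map _ i (hb i hi))
  middle {X} hX _ _ _ f g hf hfg hg i h₁ h₃ := by
    have := hX.1
    obtain ⟨w, h⟩ := exists_homComplex_shortExact X (ModuleCat.ofHom f) (ModuleCat.ofHom g) hf hfg hg
    exact P.prop_X₂_of_exact (h.homology_exact₂ i) h₃ h₁
  right {X} hX _ _ _ f g hf hfg hg i h₂ h₁ := by
    have := hX.1
    obtain ⟨w, h⟩ := exists_homComplex_shortExact X (ModuleCat.ofHom f) (ModuleCat.ofHom g) hf hfg hg
    exact P.prop_X₂_of_exact (h.homology_exact₁ (i - 1) i (by simp)) h₁ h₂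
  smulCone {X} _ N x hN i :=
    P.prop_of_iso (HomologicalComplex.homologyMapIso (mapSmulConeIso _ x X) i).symm
      (prop_homology_smulCone P x hN i)
  of_smulCone {X} _ N x m hm hN := by
    refine prop_homology_of_smulCone P x m ?_ fun i =>
      P.prop_of_iso (HomologicalComplex.homologyMapIso (mapSmulConeIso _ x X) i) (hN i)
    have : x ^ m • 𝟙 N = 0 := by ext n; exact hm n
    rw [← homComplexMap_smul, this]
    ext i (a : N ⟶ X.X i)
    exact zero_comp (f := a)
  smulCone_of_quotient {X} hX N N' x g hx hxg hg hN' i := by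
    have := hX.1
    obtain ⟨w, h⟩ := exists_homComplex_shortExact X (x • 𝟙 N) (ModuleCat.ofHom g) hx hxg hg
    refine P.prop_of_iso (HomologicalComplex.homologyMapIso (mapSmulConeIso _ x X) i).symm ?_
    simp only [homComplexMap_smul] at w h
    exact prop_homology_smulCone_of_shortExact_right P x _ w h hN' i

lemma isKoszulTheory_tensor :
    IsKoszulTheory (R := R) IsProjectiveMinus
      fun N X i => P ((tensorComplex N X).homology (-i)) where
  smulCone_mem hX x := hX.smulCone x
  of_subsingleton {X} _ N _ i := by
    refine P.prop_of_isZero (ShortComplex.isZero_homology_of_isZero_X₂ _ ?_)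
    exact Functor.map_isZero ((MonoidalCategory.tensoringRight (ModuleCat.{u} R)).obj (X.X (-i)))
      (ModuleCat.isZero_of_subsingleton N)
  bounded hX := by
    obtain ⟨-, b, hb⟩ := hX
    exact ⟨-b, fun N i hi => P.prop_of_isZero (isZero_homology_map _ _ (hb _ (by lia)))⟩
  middle {X} hX _ _ _ f g hf hfg hg i h₁ h₃ := by
    have := hX.1
    obtain ⟨w, h⟩ :=
      exists_tensorComplex_shortExact X (ModuleCat.ofHom f) (ModuleCat.ofHom g) hf hfg hg
    exact P.prop_X₂_of_exact (h.homology_exact₂ (-i)) h₁ h₃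
  right {X} hX _ _ _ f g hf hfg hg i h₂ h₁ := by
    have := hX.1
    obtain ⟨w, h⟩ :=
      exists_tensorComplex_shortExact X (ModuleCat.ofHom f) (ModuleCat.ofHom g) hf hfg hg
    exact P.prop_X₂_of_exact (h.homology_exact₃ (-i) (-(i - 1)) (by simp; lia)) h₂ h₁
  smulCone {X} _ N x hN i :=
    P.prop_of_iso (HomologicalComplex.homologyMapIso (mapSmulConeIso _ x X) _).symm
      (prop_homology_smulCone P x (fun i => by simpa using hN (-i)) (-i))
  of_smulCone {X} _ N x m hm hN i := by
    refine prop_homology_of_smulCone P x m ?_ (fun i =>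
      P.prop_of_iso (HomologicalComplex.homologyMapIso (mapSmulConeIso _ x X) i)
        (by simpa using hN (-i))) (-i)
    have : x ^ m • 𝟙 N = 0 := by ext n; exact hm n
    rw [← tensorComplexMap_smul, this]
    ext i : 2
    exact LinearMap.rTensor_zero _
  smulCone_of_quotient {X} hX N N' x g hx hxg hg hN' i := by
    have := hX.1
    obtain ⟨w, h⟩ := exists_tensorComplex_shortExact X (x • 𝟙 N) (ModuleCat.ofHom g) hx hxg hg
    refine P.prop_of_iso (HomologicalComplex.homologyMapIso (mapSmulConeIso _ x X) _).symm ?_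
    simp only [tensorComplexMap_smul] at w h
    exact prop_homology_smulCone_of_shortExact_left P x _ w h
      (fun i => by simpa using hN' (-i)) (-i)

/-- `Hom(R, X) ≅ X`. -/
noncomputable def homComplexSelfIso (X : CochainComplex (ModuleCat.{u} R) ℤ) :
    homComplex (.of R R) X ≅ X :=
  HomologicalComplex.Hom.isoOfComponents
    (fun i => (ModuleCat.homLinearEquiv (S := R) ≪≫ₗ
      LinearMap.ringLmapEquivSelf R R (X.X i)).toModuleIso)
    fun _ _ _ => rfl

/-- `R ⊗ X ≅ X`. -/
noncomputable def tensorComplexSelfIso (X : CochainComplex (ModuleCat.{u} R) ℤ) :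
    tensorComplex (.of R R) X ≅ X :=
  HomologicalComplex.Hom.isoOfComponents (fun i => MonoidalCategory.leftUnitor (X.X i))
    fun i j _ => (MonoidalCategory.leftUnitor_naturality (X.d i j)).symm

/-- If a bounded below complex of injectives `I` and a bounded above complex of projectives `K`
are isomorphic in the derived category, then the modules `H^i(Hom(R ⧸ 𝔞, I))` all belong to a Serre
class if and only if the modules `H^i(R ⧸ 𝔞 ⊗ K)` do. -/
theorem forall_homology_hom_iff_tensor [IsNoetherianRing R] (𝔞 : Ideal R)
    {I K : CochainComplex (ModuleCat.{u} R) ℤ} (hI : IsInjectivePlus I) (hK : IsProjectiveMinus K)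
    (e : IsDerivedEquiv K I) :
    (∀ i, P ((homComplex (.of R (R ⧸ 𝔞)) I).homology i)) ↔
      ∀ i, P ((tensorComplex (.of R (R ⧸ 𝔞)) K).homology i) := by
  obtain ⟨s, rfl⟩ := (IsNoetherian.noetherian 𝔞 : 𝔞.FG)
  have hs : Ideal.span (s : Set R) = Ideal.ofList s.toList := by simp [Ideal.ofList]
  change (∀ i, P ((homComplex (.of R (R ⧸ Ideal.span (s : Set R))) I).homology i)) ↔
    ∀ i, P ((tensorComplex (.of R (R ⧸ Ideal.span (s : Set R))) K).homology i)
  rw [hs, (isKoszulTheory_hom P).quotient_iff_koszul hI,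
    ← (Equiv.neg ℤ).forall_congr_right (q := fun i =>
      P ((tensorComplex (.of R (R ⧸ Ideal.ofList s.toList)) K).homology i)),
    ← (Equiv.neg ℤ).forall_congr_right]
  refine Iff.trans ?_ ((isKoszulTheory_tensor P).quotient_iff_koszul hK s.toList).symm
  refine forall_congr' fun i => ?_
  obtain ⟨e'⟩ := (e.koszul s.toList).nonempty_homology_iso (-i)
  exact P.prop_iff_of_iso
    (HomologicalComplex.homologyMapIso (homComplexSelfIso _) _ ≪≫ e'.symm ≪≫
      (HomologicalComplex.homologyMapIso (tensorComplexSelfIso _) _).symm)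

end Instances

section Extend

variable {C D : Type*} [Category C] [Category D] [Abelian C] [Abelian D] (F : C ⥤ D) [F.Additive]
  {ι ι' : Type*} {c : ComplexShape ι} {c' : ComplexShape ι'}

/-- Additive functors commute with the terms of the extension by zero of a complex. -/
noncomputable def HomologicalComplex.extend.mapXIso (K : HomologicalComplex C c) :
    ∀ o : Option ι, F.obj (extend.X K o) ≅ extend.X ((F.mapHomologicalComplex c).obj K) o
  | some _ => Iso.refl _
  | none => F.mapZeroObject

/-- Additive functors commute with the extension by zero of complexes. -/
noncomputable def HomologicalComplex.mapExtendIso (K : HomologicalComplex C c)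
    (e : c.Embedding c') :
    (F.mapHomologicalComplex c').obj (K.extend e) ≅ ((F.mapHomologicalComplex c).obj K).extend e :=
  Hom.isoOfComponents (fun i => extend.mapXIso F K (e.r i)) fun i j _ => by
    change (extend.mapXIso F K (e.r i)).hom ≫ extend.d _ _ _ =
      F.map (extend.d K _ _) ≫ (extend.mapXIso F K (e.r j)).hom
    cases e.r i with
    | none => exact (F.map_isZero (Limits.isZero_zero C)).eq_of_src _ _
    | some a => cases e.r j with
      | none => exact (Limits.isZero_zero D).eq_of_tgt _ _
      | some b => exact (Category.id_comp _).trans (Category.comp_id _).symm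

end Extend

section Homology

variable {R : Type u} [CommRing R] {ι : Type*} {c : ComplexShape ι}

/-- A linear map from the cycles of a short complex of modules onto a module `E` whose kernel
consists of the boundaries identifies the homology with `E`. -/
theorem CategoryTheory.ShortComplex.nonempty_homology_iso_of_surjective
    (S : ShortComplex (ModuleCat.{u} R)) {E : Type u} [AddCommGroup E] [Module R E]
    (φ : LinearMap.ker S.g.hom →ₗ[R] E) (hφ : Function.Surjective φ)
    (hφ' : ∀ x, φ x = 0 ↔ ∃ y, S.f.hom y = x.1) :
    Nonempty (S.homology ≅ ModuleCat.of R E) := by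
  have h : LinearMap.range S.moduleCatToCycles = LinearMap.ker φ := by
    ext x
    rw [LinearMap.mem_ker, hφ']
    exact exists_congr fun y => Subtype.ext_iff
  exact ⟨S.moduleCatHomologyIso ≪≫ LinearEquiv.toModuleIso
    ((Submodule.quotEquivOfEq _ _ h).trans (φ.quotKerEquivOfSurjective hφ))⟩

/-- A linear map from the cycles of a complex of modules onto a module `E` whose kernel consists of
the boundaries identifies the homology with `E`. -/
theorem HomologicalComplex.nonempty_homology_iso_of_surjective
    (K : HomologicalComplex (ModuleCat.{u} R) c) {i j k : ι} (hi : c.prev j = i) (hk : c.next j = k)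
    {E : Type u} [AddCommGroup E] [Module R E] (φ : LinearMap.ker (K.d j k).hom →ₗ[R] E)
    (hφ : Function.Surjective φ) (hφ' : ∀ x, φ x = 0 ↔ ∃ y, (K.d i j).hom y = x.1) :
    Nonempty (K.homology j ≅ ModuleCat.of R E) := by
  subst hi hk
  exact (K.sc j).nonempty_homology_iso_of_surjective φ hφ hφ'

end Homology

namespace CategoryTheory

open CochainComplex.HomComplex

variable {C : Type*} [Category C] [Abelian C] [HasExt.{u} C] {X Y : C}

theorem ProjectiveResolution.extMk_eq_zero_iff_of_next (Q : ProjectiveResolution X) {n : ℕ}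
    (f : Q.complex.X n ⟶ Y) (m : ℕ) (hm : n + 1 = m) (hf : Q.complex.d m n ≫ f = 0) :
    Q.extMk f m hm hf = 0 ↔
      ∃ g : Q.complex.X ((ComplexShape.up ℕ).prev n) ⟶ Y, Q.complex.d n _ ≫ g = f := by
  cases n with
  | succ p =>
    obtain hp : (ComplexShape.up ℕ).prev (p + 1) = p := by simp
    rw [hp, Q.extMk_eq_zero_iff f m hm hf p rfl]
  | zero =>
    have hd : Q.complex.d 0 ((ComplexShape.up ℕ).prev 0) = 0 := Q.complex.shape _ _ (by simp)
    simp only [hd, zero_comp, ← Q.extEquivCohomologyClass.apply_eq_iff_eq,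
      extEquivCohomologyClass_extMk, extEquivCohomologyClass_zero, CohomologyClass.mk_eq_zero_iff]
    rw [Cocycle.toSingleMk_mem_coboundaries_iff _ _ _ _ _ 1 (by simp)]
    have hz : IsZero (Q.cochainComplex.X 1) :=
      CochainComplex.isZero_of_isStrictlyLE _ 0 _ (by simp)
    have : Nonempty (Q.cochainComplex.X 1 ⟶ Y) := ⟨0⟩
    have : Nonempty (Q.complex.X ((ComplexShape.up ℕ).prev 0) ⟶ Y) := ⟨0⟩
    simp only [hz.eq_of_tgt (Q.cochainComplex.d _ _) 0, zero_comp, exists_const]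
    rw [eq_comm, Preadditive.IsIso.comp_left_eq_zero, eq_comm]

theorem ProjectiveResolution.extMk_smul {R : Type*} [Ring R] [Linear R C]
    (Q : ProjectiveResolution X) {n : ℕ} (r : R)
    (f : Q.complex.X n ⟶ Y) (m : ℕ) (hm : n + 1 = m) (hf : Q.complex.d m n ≫ f = 0) :
    Q.extMk (r • f) m hm (by simp [hf]) = r • Q.extMk f m hm hf := by
  simp [Abelian.Ext.smul_eq_comp_mk₀, Q.extMk_comp_mk₀]

theorem InjectiveResolution.extMk_smul {R : Type*} [CommRing R] [Linear R C]
    (J : InjectiveResolution Y) {n : ℕ} (r : R)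
    (f : X ⟶ J.cocomplex.X n) (m : ℕ) (hm : n + 1 = m) (hf : f ≫ J.cocomplex.d n m = 0) :
    J.extMk (r • f) m hm (by simp [hf]) = r • J.extMk f m hm hf := by
  rw [← Abelian.Ext.mk₀_id_comp (r • J.extMk f m hm hf), Abelian.Ext.comp_smul,
    ← Abelian.Ext.smul_comp, ← Abelian.Ext.mk₀_smul, J.mk₀_comp_extMk]
  simp

theorem InjectiveResolution.extMk_comp_cochainComplexXIso_eq_zero_iff (J : InjectiveResolution Y)
    {n : ℕ} (f : X ⟶ J.cochainComplex.X n) (hf) (i : ℤ) (hi : i + 1 = n) :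
    J.extMk (f ≫ (J.cochainComplexXIso n n rfl).hom) (n + 1) rfl hf = 0 ↔
      ∃ g : X ⟶ J.cochainComplex.X i, g ≫ J.cochainComplex.d i n = f := by
  simp only [← J.extEquivCohomologyClass.apply_eq_iff_eq,
    extEquivCohomologyClass_extMk, extEquivCohomologyClass_zero, CohomologyClass.mk_eq_zero_iff]
  rw [Cocycle.fromSingleMk_mem_coboundaries_iff _ _ _ _ _ i hi]
  simp

end CategoryTheory

section Modules

variable {R : Type u} [CommRing R] {N M : ModuleCat.{u} R}

/-- The `Ext` modules defined as left derived functors agree with those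
defined via the derived category. -/
theorem CategoryTheory.ProjectiveResolution.nonempty_homology_linearYonedaObj_iso
    (Q : ProjectiveResolution N) (n : ℕ) :
    Nonempty ((Q.complex.linearYonedaObj R M).homology n ≅
      ModuleCat.of R (Abelian.Ext.{u} N M n)) := by
  refine HomologicalComplex.nonempty_homology_iso_of_surjective _ rfl (k := n + 1) (by simp)
    (E := Abelian.Ext.{u} N M n)
    { toFun f := Q.extMk (n := n) f.1 (n + 1) rfl f.2
      map_add' f g := (Q.add_extMk _ _ _ _ _ _).symm
      map_smul' r f := ?_ } (fun α => ?_) fun f => ?_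
  · exact Q.extMk_smul r f.1 (n + 1) rfl f.2
  · obtain ⟨f, hf, rfl⟩ := Q.extMk_surjective α (n + 1) rfl
    exact ⟨⟨f, hf⟩, rfl⟩
  · exact Q.extMk_eq_zero_iff_of_next f.1 (n + 1) rfl f.2

theorem CategoryTheory.InjectiveResolution.nonempty_homology_homComplex_iso
    (J : InjectiveResolution M) (n : ℕ) :
    Nonempty ((homComplex N J.cochainComplex).homology n ≅
      ModuleCat.of R (Abelian.Ext.{u} N M n)) := by
  have h (f : N ⟶ J.cochainComplex.X n) (hf : f ≫ J.cochainComplex.d n (n + 1 : ℤ) = 0) :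
      (f ≫ (J.cochainComplexXIso n n rfl).hom) ≫ J.cocomplex.d n (n + 1) = 0 := by
    rw [J.cochainComplex_d n (n + 1 : ℤ) n (n + 1) rfl (by simp)] at hf
    simpa [← cancel_mono (J.cochainComplexXIso (n + 1 : ℤ) (n + 1) (by simp)).inv] using hf
  refine HomologicalComplex.nonempty_homology_iso_of_surjective _ (i := (n - 1 : ℤ))
    (k := (n + 1 : ℤ)) (by simp) (by simp) (E := Abelian.Ext.{u} N M n)
    { toFun f := J.extMk (n := n) _ (n + 1) rfl (h f.1 f.2)
      map_add' f g := ?_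
      map_smul' r f := ?_ } (fun α => ?_) fun f => ?_
  · rw [J.add_extMk]
    congr 1
    exact Preadditive.add_comp ..
  · rw [RingHom.id_apply, ← J.extMk_smul]
    congr 1
    exact Linear.smul_comp ..
  · obtain ⟨f, hf, rfl⟩ := J.extMk_surjective α (n + 1) rfl
    refine ⟨⟨f ≫ (J.cochainComplexXIso n n rfl).inv, ?_⟩, ?_⟩
    · change (f ≫ (J.cochainComplexXIso n n rfl).inv) ≫ J.cochainComplex.d n (n + 1 : ℤ) = 0
      rw [J.cochainComplex_d n (n + 1 : ℤ) n (n + 1) rfl (by simp)]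
      simp [reassoc_of% hf]
    · change J.extMk ((f ≫ (J.cochainComplexXIso n n rfl).inv) ≫
        (J.cochainComplexXIso n n rfl).hom) (n + 1) rfl (by simpa) = _
      simp
  · exact J.extMk_comp_cochainComplexXIso_eq_zero_iff f.1 (h f.1 f.2) _ (by simp)

/-- `Ext` is the cohomology of the complex of homomorphisms into an injective resolution. -/
theorem CategoryTheory.InjectiveResolution.nonempty_ext_iso (J : InjectiveResolution M) (n : ℕ) :
    Nonempty (((Ext R (ModuleCat.{u} R) n).obj (.op N)).obj M ≅
      (homComplex N J.cochainComplex).homology n) := by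
  obtain ⟨e⟩ := (projectiveResolution N).nonempty_homology_linearYonedaObj_iso (M := M) n
  obtain ⟨e'⟩ := J.nonempty_homology_homComplex_iso (N := N) n
  exact ⟨(projectiveResolution N).isoExt n M ≪≫ e ≪≫ e'.symm⟩

/-- `Tor` is the homology of the tensor product with a projective resolution. -/
theorem CategoryTheory.ProjectiveResolution.nonempty_tor_iso (Q : ProjectiveResolution M) (n : ℕ) :
    Nonempty (((Tor (ModuleCat.{u} R) n).obj N).obj M ≅
      (tensorComplex N Q.cochainComplex).homology (-n : ℤ)) := by
  refine ⟨Q.isoLeftDerivedObj ((MonoidalCategory.tensoringLeft (ModuleCat.{u} R)).obj N) n ≪≫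
    (HomologicalComplex.extendHomologyIso _ ComplexShape.embeddingDownNat rfl).symm ≪≫
    (HomologicalComplex.homologyMapIso (HomologicalComplex.mapExtendIso _ _ _) _).symm⟩

/-- For a Serre class `P` of modules, the modules `Ext^n(R ⧸ 𝔞, M)` all belong to `P` if and only if
the modules `Tor_n(R ⧸ 𝔞, M)` do. -/
theorem forall_ext_iff_forall_tor [IsNoetherianRing R] (P : ObjectProperty (ModuleCat.{u} R))
    [P.IsSerreClass] (𝔞 : Ideal R) (M : Type u) [AddCommGroup M] [Module R M] :
    (∀ n, P (extModule R (R ⧸ 𝔞) M n)) ↔ ∀ n, P (torModule R (R ⧸ 𝔞) M n) := by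
  let Q := projectiveResolution (ModuleCat.of R M)
  let J := injectiveResolution (ModuleCat.of R M)
  have hJ : IsInjectivePlus J.cochainComplex :=
    ⟨inferInstance, 0, fun i hi => CochainComplex.isZero_of_isStrictlyGE _ 0 _ hi⟩
  have hQ : IsProjectiveMinus Q.cochainComplex :=
    ⟨inferInstance, 0, fun i hi => CochainComplex.isZero_of_isStrictlyLE _ 0 _ hi⟩
  refine Iff.trans ⟨fun h i => ?_, fun h n => ?_⟩ ((forall_homology_hom_iff_tensor P 𝔞 hJ hQ
    ((IsDerivedEquiv.of_quasiIso Q.π').trans (.of_quasiIso J.ι'))).trans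
      ⟨fun h n => ?_, fun h i => ?_⟩)
  · obtain hi | hi := lt_or_ge i 0
    · exact P.prop_of_isZero (isZero_homology_map _ i
        (CochainComplex.isZero_of_isStrictlyGE _ 0 _ hi))
    · lift i to ℕ using hi
      exact P.prop_of_iso (J.nonempty_ext_iso i).some (h i)
  · exact P.prop_of_iso (J.nonempty_ext_iso n).some.symm (h n)
  · exact P.prop_of_iso (Q.nonempty_tor_iso n).some.symm (h (-n))
  · obtain hi | hi := lt_or_ge 0 i
    · exact P.prop_of_isZero (isZero_homology_map _ i
        (CochainComplex.isZero_of_isStrictlyLE _ 0 _ hi))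
    · obtain ⟨n, rfl⟩ := Int.exists_eq_neg_ofNat hi
      exact P.prop_of_iso (Q.nonempty_tor_iso n).some (h n)

end Modules

/-- `Ext^i_R(R/𝔞, M) ∈ 𝒮` for all `i` iff `Tor_i^R(R/𝔞, M) ∈ 𝒮` for all `i`. -/
theorem serre_ext_iff_tor
    (R : Type u) [CommRing R] [IsNoetherianRing R] (𝔞 : Ideal R) (𝒮 : SerreClass R)
    (M : Type u) [AddCommGroup M] [Module R M] :
    (∀ i : ℕ, 𝒮.mem (extModule R (R ⧸ 𝔞) M i)) ↔
      (∀ i : ℕ, 𝒮.mem (torModule R (R ⧸ 𝔞) M i)) := by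
  refine ⟨fun h => ?_, fun h => ?_⟩
  · have := 𝒮.isSerreClass ⟨_, h 0⟩
    exact (forall_ext_iff_forall_tor 𝒮.toObjectProperty 𝔞 M).1 h
  · have := 𝒮.isSerreClass ⟨_, h 0⟩
    exact (forall_ext_iff_forall_tor 𝒮.toObjectProperty 𝔞 M).2 h
end

section
/- Let R be a commutative Noetherian ring, 𝔞 an ideal of R, and 𝒮 a Serre subcategory of the category of R-modules. Let M be an R-module such that Ext^i_R(R/𝔞, M) belongs to 𝒮 for all i ≥ 0 (equivalently, Tor_i^R(R/𝔞, M) belongs to 𝒮 for all i ≥ 0). Then for every finitely generated R-module N with Supp_R(N) ⊆ V(𝔞), the modules Ext^i_R(N, M) and Tor_i^R(N, M) belong to 𝒮 for all i ≥ 0. -/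
universe u

open CategoryTheory

namespace SerreClass

variable {R : Type u} [CommRing R] (𝒮 : SerreClass R)
  {A B C : Type u} [AddCommGroup A] [Module R A] [AddCommGroup B] [Module R B]
  [AddCommGroup C] [Module R C]

lemma mem_of_injective_s9 (f : A →ₗ[R] B) (hf : Function.Injective f) (hB : 𝒮.mem B) : 𝒮.mem A :=
  𝒮.mem_of_linearEquiv _ _ (LinearEquiv.ofInjective f hf).symm (𝒮.mem_submodule _ _ hB)

lemma mem_of_surjective_s9 (f : A →ₗ[R] B) (hf : Function.Surjective f) (hA : 𝒮.mem A) : 𝒮.mem B :=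
  𝒮.mem_of_linearEquiv _ _ (f.quotKerEquivOfSurjective hf) (𝒮.mem_quotient _ _ hA)

lemma mem_of_exact (f : A →ₗ[R] B) (g : B →ₗ[R] C) (hfg : Function.Exact f g)
    (hA : 𝒮.mem A) (hC : 𝒮.mem C) : 𝒮.mem B := by
  refine 𝒮.mem_extension B (LinearMap.ker g) ?_ ?_
  · rw [LinearMap.exact_iff.1 hfg]
    exact 𝒮.mem_of_surjective_s9 f.rangeRestrict f.surjective_rangeRestrict hA
  · exact 𝒮.mem_of_injective_s9 (g.quotKerEquivRange.toLinearMap) g.quotKerEquivRange.injective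
      (𝒮.mem_submodule _ _ hC)

lemma mem_of_subsingleton (hA : 𝒮.mem A) [Subsingleton B] : 𝒮.mem B :=
  𝒮.mem_of_injective_s9 (0 : B →ₗ[R] A) (Function.injective_of_subsingleton _) hA

end SerreClass

/-- A predicate on `R`-modules that is closed under extensions. -/
def ClosedUnderExtensions (R : Type u) [CommRing R]
    (P : ∀ (N : Type u) [AddCommGroup N] [Module R N], Prop) : Prop :=
  ∀ (A B C : Type u) [AddCommGroup A] [Module R A] [AddCommGroup B] [Module R B]
    [AddCommGroup C] [Module R C] (f : A →ₗ[R] B) (g : B →ₗ[R] C),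
    Function.Injective f → Function.Exact f g → Function.Surjective g → P A → P C → P B

section Devissage

variable {R : Type u} [CommRing R] {P : ∀ (N : Type u) [AddCommGroup N] [Module R N], Prop}

lemma ClosedUnderExtensions.pi (hP : ClosedUnderExtensions R P) (h0 : P PUnit.{u + 1})
    (A : Type u) [AddCommGroup A] [Module R A] (hA : P A) (n : ℕ) : P (Fin n → A) := by
  induction n with
  | zero =>
    refine hP PUnit (Fin 0 → A) PUnit 0 0 (Function.injective_of_subsingleton _) ?_
      (Function.surjective_to_subsingleton _) h0 h0
    intro x
    simp [Subsingleton.elim x 0]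
  | succ n ih =>
    refine hP A (Fin (n + 1) → A) (Fin n → A) (LinearMap.single R (fun _ => A) 0)
      (LinearMap.funLeft R A Fin.succ) (Pi.single_injective (M := fun _ => A) 0) ?_ ?_ hA ih
    · intro x
      constructor
      · intro h
        refine ⟨x 0, ?_⟩
        ext i
        refine Fin.cases ?_ (fun i => ?_) i
        · simp
        · simpa using (congrFun h i).symm
      · rintro ⟨y, rfl⟩
        ext i
        simp [LinearMap.funLeft]
    · exact LinearMap.funLeft_surjective_of_injective R A _ (Fin.succ_injective n)

lemma exists_surjective_pi_quotient (𝔞 : Ideal R) (N : Type u) [AddCommGroup N] [Module R N]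
    [Module.Finite R N] (hN : ∀ x ∈ 𝔞, ∀ y : N, x • y = 0) :
    ∃ (n : ℕ) (f : (Fin n → R ⧸ 𝔞) →ₗ[R] N), Function.Surjective f := by
  obtain ⟨n, s, hs⟩ := Module.Finite.exists_fin (R := R) (M := N)
  let q : ∀ i, (R ⧸ 𝔞) →ₗ[R] N := fun i =>
    Submodule.liftQ 𝔞 (LinearMap.toSpanSingleton R N (s i)) (fun x hx => by simp [hN x hx])
  refine ⟨n, LinearMap.lsum R (fun _ => R ⧸ 𝔞) R q, ?_⟩
  rw [← LinearMap.range_eq_top, eq_top_iff, ← hs, Submodule.span_le]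
  rintro _ ⟨i, rfl⟩
  refine ⟨Pi.single i (Submodule.Quotient.mk 1), ?_⟩
  rw [LinearMap.lsum_piSingle]
  change LinearMap.toSpanSingleton R N (s i) 1 = s i
  simp

lemma ClosedUnderExtensions.of_support_subset [IsNoetherianRing R]
    (hP : ClosedUnderExtensions R P) (𝔞 : Ideal R)
    (h : ∀ (N : Type u) [AddCommGroup N] [Module R N] [Module.Finite R N],
      (∀ x ∈ 𝔞, ∀ y : N, x • y = 0) → P N)
    (N : Type u) [AddCommGroup N] [Module R N] [Module.Finite R N]
    (hN : Module.support R N ⊆ PrimeSpectrum.zeroLocus (𝔞 : Set R)) : P N := by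
  obtain ⟨k, hk⟩ : ∃ k, 𝔞 ^ k ≤ Module.annihilator R N := by
    refine Ideal.exists_pow_le_of_le_radical_of_fg ?_ (IsNoetherian.noetherian 𝔞)
    rw [Module.support_eq_zeroLocus, PrimeSpectrum.zeroLocus_subset_zeroLocus_iff] at hN
    exact hN
  clear hN
  induction k generalizing N with
  | zero =>
    refine h N fun x _ y => ?_
    have h1 : (1 : R) ∈ Module.annihilator R N := hk (by simp)
    rw [← one_smul R y, Module.mem_annihilator.1 h1, smul_zero]
  | succ k ih =>
    let N' : Submodule R N := 𝔞 • ⊤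
    refine hP N' N (N ⧸ N') N'.subtype N'.mkQ N'.injective_subtype ?_ N'.mkQ_surjective ?_ ?_
    · exact LinearMap.exact_subtype_mkQ N'
    · have key : ∀ x ∈ 𝔞 ^ k, ∀ y ∈ N', x • y = 0 := fun x hx y hy => by
        refine Submodule.smul_induction_on hy (fun r hr z _ => ?_) (fun y z hy hz => ?_)
        · rw [smul_smul]
          exact Module.mem_annihilator.1 (hk (pow_succ 𝔞 k ▸ Ideal.mul_mem_mul hx hr)) z
        · rw [smul_add, hy, hz, add_zero]
      exact ih N' fun x hx => Module.mem_annihilator.2 fun y => Subtype.ext (key x hx y y.2)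
    · refine h (N ⧸ N') fun x hx y => ?_
      obtain ⟨y, rfl⟩ := N'.mkQ_surjective y
      rw [← map_smul, Submodule.mkQ_apply, Submodule.Quotient.mk_eq_zero]
      exact Submodule.smul_mem_smul hx trivial

end Devissage

section ExtComparison

open CategoryTheory.Abelian

variable {R : Type u} [CommRing R]

/-- A surjection from the cycles killing exactly the boundaries computes the homology. -/
noncomputable def homologyLinearEquivOfSurjective (S : ShortComplex (ModuleCat.{u} R))
    {E : Type u} [AddCommGroup E] [Module R E] (φ : LinearMap.ker S.g.hom →ₗ[R] E)
    (hφ : Function.Surjective φ)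
    (h : ∀ x, φ x = 0 ↔ ∃ y : S.X₁, S.f y = (x : S.X₂)) : S.homology ≃ₗ[R] E :=
  S.moduleCatHomologyIso.toLinearEquiv.trans
    ((Submodule.quotEquivOfEq _ _ (by
      ext x
      rw [LinearMap.mem_ker, h]
      exact ⟨fun ⟨y, hy⟩ => ⟨y, congrArg Subtype.val hy⟩, fun ⟨y, hy⟩ => ⟨y, Subtype.ext hy⟩⟩)).trans
      (φ.quotKerEquivOfSurjective hφ))

lemma CategoryTheory.ProjectiveResolution.extMk_eq_zero_iff_of_zero {C : Type*} [Category* C]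
    [Abelian C] [HasExt C] {X Y : C} (P : ProjectiveResolution X) (f : P.complex.X 0 ⟶ Y)
    (m : ℕ) (hm : 0 + 1 = m) (hf : P.complex.d m 0 ≫ f = 0) : P.extMk f m hm hf = 0 ↔ f = 0 := by
  simp only [← P.extEquivCohomologyClass.apply_eq_iff_eq,
    P.extEquivCohomologyClass_extMk, P.extEquivCohomologyClass_zero,
    CochainComplex.HomComplex.CohomologyClass.mk_eq_zero_iff]
  rw [CochainComplex.HomComplex.Cocycle.toSingleMk_mem_coboundaries_iff _ _ _ _ _ 1 (by simp)]
  have h1 : P.cochainComplex.d (-((0 : ℕ) : ℤ)) 1 = 0 :=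
    (P.cochainComplex.isZero_of_isStrictlyLE 0 1 (by simp)).eq_of_tgt _ _
  constructor
  · rintro ⟨g, hg⟩
    rw [h1, Limits.zero_comp] at hg
    rw [← cancel_epi (P.cochainComplexXIso (-((0 : ℕ) : ℤ)) 0 rfl).hom, Limits.comp_zero]
    exact hg.symm
  · rintro rfl
    exact ⟨0, by simp⟩

variable (N M : Type u) [AddCommGroup N] [Module R N] [AddCommGroup M] [Module R M]

lemma smul_extMk {X Y : ModuleCat.{u} R} (P : ProjectiveResolution X) {n : ℕ} (r : R)
    (f : P.complex.X n ⟶ Y) (m : ℕ) (hm : n + 1 = m) (hf : P.complex.d m n ≫ f = 0) :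
    r • P.extMk f m hm hf = P.extMk (r • f) m hm (by simp [hf]) := by
  rw [Ext.smul_eq_comp_mk₀, P.extMk_comp_mk₀]
  congr 1

lemma nonempty_extModule_linearEquiv (i : ℕ) :
    Nonempty (extModule R N M i ≃ₗ[R] Ext (ModuleCat.of R N) (ModuleCat.of R M) i) := by
  let P := projectiveResolution (ModuleCat.of R N)
  let Y := ModuleCat.of R M
  let S := (P.complex.linearYonedaObj R Y).sc i
  let e : extModule R N M i ≃ₗ[R] S.homology := (P.isoExt i Y).toLinearEquiv
  have hn : i + 1 = (ComplexShape.up ℕ).next i := by simp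
  have hker : ∀ f : P.complex.X i ⟶ Y, f ∈ LinearMap.ker S.g.hom →
      P.complex.d ((ComplexShape.up ℕ).next i) i ≫ f = 0 := fun f hf => hf
  let φ : LinearMap.ker S.g.hom →ₗ[R] Ext (ModuleCat.of R N) (ModuleCat.of R M) i :=
    { toFun := fun f => P.extMk (Y := Y) f.1 _ hn (hker f.1 f.2)
      map_add' := fun f g => (P.add_extMk (Y := Y) f.1 g.1 _ hn (hker f.1 f.2) (hker g.1 g.2)).symm
      map_smul' := fun r f => (smul_extMk P (Y := Y) r f.1 _ hn (hker f.1 f.2)).symm }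
  refine ⟨e.trans (homologyLinearEquivOfSurjective S φ ?_ ?_)⟩
  · intro α
    obtain ⟨f, hf, rfl⟩ := P.extMk_surjective α _ hn
    exact ⟨⟨f, hf⟩, rfl⟩
  · rintro ⟨f, hf⟩
    change P.extMk (Y := Y) f _ hn (hker f hf) = 0 ↔
      ∃ g : P.complex.X ((ComplexShape.up ℕ).prev i) ⟶ Y,
        P.complex.d i ((ComplexShape.up ℕ).prev i) ≫ g = f
    cases i with
    | zero =>
      refine (P.extMk_eq_zero_iff_of_zero (Y := Y) f _ hn (hker f hf)).trans ?_
      have hd : P.complex.d 0 ((ComplexShape.up ℕ).prev 0) = 0 := P.complex.shape _ _ (by simp)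
      rw [hd]
      constructor
      · rintro rfl
        exact ⟨0, by simp⟩
      · rintro ⟨g, rfl⟩
        simp
    | succ i => exact P.extMk_eq_zero_iff (Y := Y) f _ hn (hker f hf) _ (by simp)

end ExtComparison

section ExtSequence

open CategoryTheory.Abelian

variable {R : Type u} [CommRing R]

/-- Composition with a fixed extension class on the left, as a linear map. -/
noncomputable def CategoryTheory.Abelian.Ext.precompLinear {X Y : ModuleCat.{u} R} {a : ℕ}
    (α : Ext X Y a) (Z : ModuleCat.{u} R) {b c : ℕ} (h : a + b = c) :
    Ext Y Z b →ₗ[R] Ext X Z c where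
  toFun β := α.comp β h
  map_add' := by simp
  map_smul' := by simp

variable {A B C : Type u} [AddCommGroup A] [Module R A] [AddCommGroup B] [Module R B]
  [AddCommGroup C] [Module R C] {f : A →ₗ[R] B} {g : B →ₗ[R] C}

lemma moduleCat_shortExact (hf : Function.Injective f) (hfg : Function.Exact f g)
    (hg : Function.Surjective g) :
    (ModuleCat.shortComplexOfCompEqZero f g hfg.linearMap_comp_eq_zero).ShortExact :=
  ModuleCat.shortComplex_shortExact _ hfg hf hg

variable (𝒮 : SerreClass R) (M : Type u) [AddCommGroup M] [Module R M]

lemma mem_ext_X₂ (hf : Function.Injective f) (hfg : Function.Exact f g)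
    (hg : Function.Surjective g) (i : ℕ)
    (hA : 𝒮.mem (Ext (ModuleCat.of R A) (ModuleCat.of R M) i))
    (hC : 𝒮.mem (Ext (ModuleCat.of R C) (ModuleCat.of R M) i)) :
    𝒮.mem (Ext (ModuleCat.of R B) (ModuleCat.of R M) i) := by
  have hS := moduleCat_shortExact hf hfg hg
  refine 𝒮.mem_of_exact ((Ext.mk₀ (ModuleCat.ofHom g)).precompLinear _ (zero_add i))
    ((Ext.mk₀ (ModuleCat.ofHom f)).precompLinear _ (zero_add i)) (fun x => ⟨fun h => ?_, ?_⟩) hC hA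
  · exact Ext.contravariant_sequence_exact₂ hS _ x h
  · rintro ⟨y, rfl⟩
    exact (ShortComplex.ab_exact_iff_function_exact _).1
      (Ext.contravariant_sequence_exact₂' hS (ModuleCat.of R M) i) |>.apply_apply_eq_zero y

lemma mem_ext_X₃ (hf : Function.Injective f) (hfg : Function.Exact f g)
    (hg : Function.Surjective g) (i : ℕ)
    (hA : 𝒮.mem (Ext (ModuleCat.of R A) (ModuleCat.of R M) i))
    (hB : 𝒮.mem (Ext (ModuleCat.of R B) (ModuleCat.of R M) (i + 1))) :
    𝒮.mem (Ext (ModuleCat.of R C) (ModuleCat.of R M) (i + 1)) := by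
  have hS := moduleCat_shortExact hf hfg hg
  refine 𝒮.mem_of_exact (hS.extClass.precompLinear _ (add_comm 1 i))
    ((Ext.mk₀ (ModuleCat.ofHom g)).precompLinear _ (zero_add (i + 1))) (fun x => ⟨fun h => ?_, ?_⟩)
    hA hB
  · exact Ext.contravariant_sequence_exact₃ hS _ x h (add_comm 1 i)
  · rintro ⟨y, rfl⟩
    exact (ShortComplex.ab_exact_iff_function_exact _).1
      (Ext.contravariant_sequence_exact₃' hS (ModuleCat.of R M) i (i + 1) (add_comm 1 i))
        |>.apply_apply_eq_zero y

lemma mem_ext_X₁ (hf : Function.Injective f) (hfg : Function.Exact f g)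
    (hg : Function.Surjective g) (i : ℕ)
    (hB : 𝒮.mem (Ext (ModuleCat.of R B) (ModuleCat.of R M) i))
    (hC : 𝒮.mem (Ext (ModuleCat.of R C) (ModuleCat.of R M) (i + 1))) :
    𝒮.mem (Ext (ModuleCat.of R A) (ModuleCat.of R M) i) := by
  have hS := moduleCat_shortExact hf hfg hg
  refine 𝒮.mem_of_exact ((Ext.mk₀ (ModuleCat.ofHom f)).precompLinear _ (zero_add i))
    (hS.extClass.precompLinear _ (add_comm 1 i)) (fun x => ⟨fun h => ?_, ?_⟩) hB hC
  · exact Ext.contravariant_sequence_exact₁ hS _ x (add_comm 1 i) h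
  · rintro ⟨y, rfl⟩
    exact (ShortComplex.ab_exact_iff_function_exact _).1
      (Ext.contravariant_sequence_exact₁' hS (ModuleCat.of R M) i (i + 1) (add_comm 1 i))
        |>.apply_apply_eq_zero y

/-- `Ext⁰` is the module of linear maps. -/
noncomputable def homLinearEquivExt (N : Type u) [AddCommGroup N] [Module R N] :
    (N →ₗ[R] M) ≃ₗ[R] Ext (ModuleCat.of R N) (ModuleCat.of R M) 0 :=
  (ModuleCat.homLinearEquiv (S := R) (M := ModuleCat.of R N) (N := ModuleCat.of R M)).symm.trans
    (Ext.linearEquiv₀ (R := R)).symm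

lemma mem_ext_zero_iff (N : Type u) [AddCommGroup N] [Module R N] :
    𝒮.mem (Ext (ModuleCat.of R N) (ModuleCat.of R M) 0) ↔ 𝒮.mem (N →ₗ[R] M) :=
  ⟨𝒮.mem_of_linearEquiv _ _ (homLinearEquivExt M N).symm,
    𝒮.mem_of_linearEquiv _ _ (homLinearEquivExt M N)⟩

lemma exists_hom_to_ext_one_exact (hf : Function.Injective f) (hfg : Function.Exact f g)
    (hg : Function.Surjective g) :
    ∃ δ : (A →ₗ[R] M) →ₗ[R] Ext (ModuleCat.of R C) (ModuleCat.of R M) 1,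
      ∀ φ, δ φ = 0 → ∃ ψ : B →ₗ[R] M, ψ ∘ₗ f = φ := by
  have hS := moduleCat_shortExact hf hfg hg
  refine ⟨hS.extClass.precompLinear _ (add_zero 1) ∘ₗ (homLinearEquivExt M A).toLinearMap,
    fun φ h => ?_⟩
  obtain ⟨x, hx⟩ := Ext.contravariant_sequence_exact₁ hS _ (homLinearEquivExt M A φ) (add_zero 1) h
  obtain ⟨ψ, rfl⟩ := (homLinearEquivExt M B).surjective x
  refine ⟨ψ, (homLinearEquivExt M A).injective (Eq.trans ?_ hx)⟩
  exact (Ext.mk₀_comp_mk₀ (ModuleCat.ofHom f) (ModuleCat.ofHom ψ)).symm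

lemma mem_ext_of_projective (N : Type u) [AddCommGroup N] [Module R N] [Module.Projective R N]
    (i : ℕ) {L : Type u} [AddCommGroup L] [Module R L] (hL : 𝒮.mem L) :
    𝒮.mem (Ext (ModuleCat.of R N) (ModuleCat.of R M) (i + 1)) :=
  have : Projective (ModuleCat.of R N) := (IsProjective.iff_projective (R := R) N).1 inferInstance
  have := Ext.subsingleton_of_projective (ModuleCat.of R N) (ModuleCat.of R M) i
  𝒮.mem_of_subsingleton hL

end ExtSequence

section TorSequence

open CategoryTheory.MonoidalCategory

lemma CategoryTheory.ProjectiveResolution.fromLeftDerivedZero'_natTrans_naturality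
    {C D : Type*} [Category* C] [Category* D] [Abelian C] [Abelian D] {X : C}
    (P : ProjectiveResolution X) {F G : C ⥤ D} [F.Additive] [G.Additive] (α : F ⟶ G) :
    HomologicalComplex.opcyclesMap ((NatTrans.mapHomologicalComplex α _).app P.complex) 0 ≫
      P.fromLeftDerivedZero' G = P.fromLeftDerivedZero' F ≫ α.app X := by
  have hF : HomologicalComplex.pOpcycles _ _ ≫ P.fromLeftDerivedZero' F = F.map (P.π.f 0) :=
    P.pOpcycles_comp_fromLeftDerivedZero' _
  have hG : HomologicalComplex.pOpcycles _ _ ≫ P.fromLeftDerivedZero' G = G.map (P.π.f 0) :=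
    P.pOpcycles_comp_fromLeftDerivedZero' _
  rw [← cancel_epi (HomologicalComplex.pOpcycles _ _), HomologicalComplex.p_opcyclesMap_assoc,
    hG, reassoc_of% hF]
  exact (α.naturality _).symm

variable {R : Type u} [CommRing R]

/-- The complex `N ⊗ P`, where `P` is a projective resolution of `M`. -/
noncomputable def torComplex (N M : Type u) [AddCommGroup N] [Module R N] [AddCommGroup M]
    [Module R M] : ChainComplex (ModuleCat.{u} R) ℕ :=
  (((tensoringLeft (ModuleCat.{u} R)).obj (ModuleCat.of R N)).mapHomologicalComplex _).obj
    (projectiveResolution (ModuleCat.of R M)).complex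

/-- `Tor` is the homology of `torComplex`. -/
noncomputable def torLinearEquiv (N M : Type u) [AddCommGroup N] [Module R N] [AddCommGroup M]
    [Module R M] (i : ℕ) : torModule R N M i ≃ₗ[R] (torComplex (R := R) N M).homology i :=
  ((projectiveResolution (ModuleCat.of R M)).isoLeftDerivedObj
    ((tensoringLeft (ModuleCat.{u} R)).obj (ModuleCat.of R N)) i).toLinearEquiv

variable {A B C : Type u} [AddCommGroup A] [Module R A] [AddCommGroup B] [Module R B]
  [AddCommGroup C] [Module R C] {f : A →ₗ[R] B} {g : B →ₗ[R] C}

/-- The map on `torComplex` induced by a linear map. -/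
noncomputable def torComplexMap (f : A →ₗ[R] B) (M : Type u) [AddCommGroup M] [Module R M] :
    torComplex (R := R) A M ⟶ torComplex (R := R) B M :=
  (NatTrans.mapHomologicalComplex ((tensoringLeft (ModuleCat.{u} R)).map (ModuleCat.ofHom f)) _).app
    (projectiveResolution (ModuleCat.of R M)).complex

lemma torComplexMap_comp_eq_zero (hfg : Function.Exact f g) (M : Type u) [AddCommGroup M]
    [Module R M] : torComplexMap f M ≫ torComplexMap g M = 0 := by
  ext n : 1
  exact ModuleCat.hom_ext ((LinearMap.rTensor_comp _ g f).symm.trans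
    (by rw [hfg.linearMap_comp_eq_zero, LinearMap.rTensor_zero]; rfl))

lemma torComplex_shortExact (hf : Function.Injective f) (hfg : Function.Exact f g)
    (hg : Function.Surjective g) (M : Type u) [AddCommGroup M] [Module R M] :
    (ShortComplex.mk _ _ (torComplexMap_comp_eq_zero hfg M)).ShortExact := by
  refine HomologicalComplex.shortExact_of_degreewise_shortExact _ fun n => ?_
  let Q := (projectiveResolution (ModuleCat.of R M)).complex.X n
  have : Module.Projective R Q := (IsProjective.iff_projective (R := R) Q).2
    ((projectiveResolution (ModuleCat.of R M)).projective n)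
  refine ModuleCat.shortComplex_shortExact _ ?_ ?_ ?_
  · exact rTensor_exact Q hfg hg
  · exact Module.Flat.rTensor_preserves_injective_linearMap (M := Q) f hf
  · exact LinearMap.rTensor_surjective Q hg

variable (𝒮 : SerreClass R) (M : Type u) [AddCommGroup M] [Module R M]

lemma mem_tor_iff (N : Type u) [AddCommGroup N] [Module R N] (i : ℕ) :
    𝒮.mem (torModule R N M i) ↔ 𝒮.mem ((torComplex (R := R) N M).homology i) :=
  ⟨𝒮.mem_of_linearEquiv _ _ (torLinearEquiv N M i),
    𝒮.mem_of_linearEquiv _ _ (torLinearEquiv N M i).symm⟩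

lemma SerreClass.mem_of_shortComplex_exact {S : ShortComplex (ModuleCat.{u} R)} (hS : S.Exact)
    (h₁ : 𝒮.mem S.X₁) (h₃ : 𝒮.mem S.X₃) : 𝒮.mem S.X₂ :=
  𝒮.mem_of_exact S.f.hom S.g.hom
    ((ShortComplex.ShortExact.moduleCat_exact_iff_function_exact S).1 hS) h₁ h₃

lemma mem_tor_X₂ (hf : Function.Injective f) (hfg : Function.Exact f g)
    (hg : Function.Surjective g) (i : ℕ) (hA : 𝒮.mem (torModule R A M i))
    (hC : 𝒮.mem (torModule R C M i)) : 𝒮.mem (torModule R B M i) := by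
  rw [mem_tor_iff] at *
  exact 𝒮.mem_of_shortComplex_exact ((torComplex_shortExact hf hfg hg M).homology_exact₂ i) hA hC

lemma mem_tor_X₃ (hf : Function.Injective f) (hfg : Function.Exact f g)
    (hg : Function.Surjective g) (i : ℕ) (hA : 𝒮.mem (torModule R A M i))
    (hB : 𝒮.mem (torModule R B M (i + 1))) : 𝒮.mem (torModule R C M (i + 1)) := by
  rw [mem_tor_iff] at *
  exact 𝒮.mem_of_shortComplex_exact
    ((torComplex_shortExact hf hfg hg M).homology_exact₃ (i + 1) i rfl) hB hA

lemma subsingleton_tor_of_flat (N : Type u) [AddCommGroup N] [Module R N] [Module.Flat R N]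
    (i : ℕ) : Subsingleton (torModule R N M (i + 1)) := by
  let P := projectiveResolution (ModuleCat.of R M)
  have h : (torComplex (R := R) N M).ExactAt (i + 1) := by
    rw [HomologicalComplex.exactAt_iff' _ (i + 2) (i + 1) i (by simp) (by simp),
      ShortComplex.ShortExact.moduleCat_exact_iff_function_exact]
    have hP := P.complex_exactAt_succ i
    rw [HomologicalComplex.exactAt_iff' _ (i + 2) (i + 1) i (by simp) (by simp),
      ShortComplex.ShortExact.moduleCat_exact_iff_function_exact] at hP
    exact Module.Flat.lTensor_exact N hP
  have := ModuleCat.subsingleton_of_isZero h.isZero_homology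
  exact (torLinearEquiv N M (i + 1)).toEquiv.subsingleton

open TensorProduct

/-- The isomorphism `Tor₀(N, M) ≅ N ⊗ M`. -/
noncomputable def torComplexHomologyZeroIso (N : Type u) [AddCommGroup N] [Module R N] :
    (torComplex (R := R) N M).homology 0 ≅ ModuleCat.of R (N ⊗[R] M) :=
  have : Limits.PreservesFiniteColimits
      ((tensoringLeft (ModuleCat.{u} R)).obj (ModuleCat.of R N)) :=
    inferInstanceAs (Limits.PreservesFiniteColimits (tensorLeft (ModuleCat.of R N)))
  let e := asIso ((projectiveResolution (ModuleCat.of R M)).fromLeftDerivedZero'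
    ((tensoringLeft (ModuleCat.{u} R)).obj (ModuleCat.of R N)))
  ChainComplex.isoHomologyι₀ _ ≪≫ e

lemma torComplexHomologyZeroIso_naturality (f : A →ₗ[R] B) :
    HomologicalComplex.homologyMap (torComplexMap f M) 0 ≫ (torComplexHomologyZeroIso M B).hom =
      (torComplexHomologyZeroIso M A).hom ≫ ModuleCat.ofHom (f.rTensor M) := by
  have key : HomologicalComplex.opcyclesMap (torComplexMap f M) 0 ≫
      (projectiveResolution (ModuleCat.of R M)).fromLeftDerivedZero'
        ((tensoringLeft (ModuleCat.{u} R)).obj (ModuleCat.of R B)) =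
      (projectiveResolution (ModuleCat.of R M)).fromLeftDerivedZero'
        ((tensoringLeft (ModuleCat.{u} R)).obj (ModuleCat.of R A)) ≫
          ((tensoringLeft (ModuleCat.{u} R)).map (ModuleCat.ofHom f)).app _ :=
    (projectiveResolution (ModuleCat.of R M)).fromLeftDerivedZero'_natTrans_naturality
      ((tensoringLeft (ModuleCat.{u} R)).map (ModuleCat.ofHom f))
  change _ ≫ (HomologicalComplex.homologyι _ _ ≫ _) = (HomologicalComplex.homologyι _ _ ≫ _) ≫ _
  exact (HomologicalComplex.homologyι_naturality_assoc _ _ _).trans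
    ((congrArg (HomologicalComplex.homologyι _ _ ≫ ·) key).trans (Category.assoc _ _ _).symm)

lemma mem_tor_zero_iff (N : Type u) [AddCommGroup N] [Module R N] :
    𝒮.mem (torModule R N M 0) ↔ 𝒮.mem (N ⊗[R] M) := by
  rw [mem_tor_iff]
  exact ⟨𝒮.mem_of_linearEquiv _ _ (torComplexHomologyZeroIso M N).toLinearEquiv,
    𝒮.mem_of_linearEquiv _ _ (torComplexHomologyZeroIso M N).toLinearEquiv.symm⟩

lemma mem_tor_one_of_mem_ker_rTensor [Module.Flat R B] (hf : Function.Injective f)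
    (hfg : Function.Exact f g) (hg : Function.Surjective g)
    (h : 𝒮.mem (LinearMap.ker (f.rTensor M))) : 𝒮.mem (torModule R C M 1) := by
  rw [mem_tor_iff]
  have hS := torComplex_shortExact hf hfg hg M
  have : Subsingleton ((torComplex (R := R) B M).homology 1) :=
    have := subsingleton_tor_of_flat (R := R) M B 0
    (torLinearEquiv B M 1).symm.toEquiv.subsingleton
  let δ := hS.δ 1 0 rfl
  have h₁ := (ShortComplex.ShortExact.moduleCat_exact_iff_function_exact _).1
    (hS.homology_exact₁ 1 0 rfl)
  have h₃ := (ShortComplex.ShortExact.moduleCat_exact_iff_function_exact _).1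
    (hS.homology_exact₃ 1 0 rfl)
  have hδ : Function.Injective δ.hom := by
    rw [injective_iff_map_eq_zero]
    intro x hx
    obtain ⟨y, rfl⟩ := (h₃ x).1 hx
    have hy : y = 0 := Subsingleton.elim (α := (torComplex (R := R) B M).homology 1) y 0
    rw [hy, map_zero]
  let e : _ ≃ₗ[R] A ⊗[R] M := (torComplexHomologyZeroIso (R := R) M A).toLinearEquiv
  refine 𝒮.mem_of_injective_s9 ((e.toLinearMap ∘ₗ δ.hom).codRestrict (LinearMap.ker (f.rTensor M))
    fun x => ?_) (fun x y hxy => hδ (e.injective (congrArg Subtype.val hxy))) h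
  have h0 := (h₁ (δ.hom x)).2 ⟨x, rfl⟩
  have h2 := congrArg (fun φ => φ.hom (δ.hom x)) (torComplexHomologyZeroIso_naturality M f)
  refine h2.symm.trans ?_
  exact (congrArg (torComplexHomologyZeroIso (R := R) M B).hom.hom h0).trans (map_zero _)

end TorSequence

section DevissageExtTor

open CategoryTheory.Abelian TensorProduct

variable {R : Type u} [CommRing R] (𝒮 : SerreClass R) (M : Type u) [AddCommGroup M] [Module R M]

lemma closedUnderExtensions_ext (i : ℕ) : ClosedUnderExtensions R fun N _ _ =>
    𝒮.mem (Ext (ModuleCat.of R N) (ModuleCat.of R M) i) :=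
  fun _ _ _ _ _ _ _ _ _ _ _ hf hfg hg hA hC => mem_ext_X₂ 𝒮 M hf hfg hg i hA hC

lemma closedUnderExtensions_tor (i : ℕ) : ClosedUnderExtensions R fun N _ _ =>
    𝒮.mem (torModule R N M i) :=
  fun _ _ _ _ _ _ _ _ _ _ _ hf hfg hg hA hC => mem_tor_X₂ 𝒮 M hf hfg hg i hA hC

variable {L : Type u} [AddCommGroup L] [Module R L]

lemma mem_ext_punit (hL : 𝒮.mem L) (i : ℕ) :
    𝒮.mem (Ext (ModuleCat.of R PUnit.{u + 1}) (ModuleCat.of R M) i) := by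
  cases i with
  | zero => exact (mem_ext_zero_iff 𝒮 M PUnit).2 (𝒮.mem_of_subsingleton hL)
  | succ i => exact mem_ext_of_projective 𝒮 M PUnit i hL

lemma mem_tor_punit (hL : 𝒮.mem L) (i : ℕ) : 𝒮.mem (torModule R PUnit.{u + 1} M i) := by
  cases i with
  | zero => exact (mem_tor_zero_iff 𝒮 M PUnit).2 (𝒮.mem_of_subsingleton hL)
  | succ i =>
    have := subsingleton_tor_of_flat (R := R) M PUnit i
    exact 𝒮.mem_of_subsingleton hL

variable {𝔞 : Ideal R}

lemma smul_pi_quotient_eq_zero {n : ℕ} {x : R} (hx : x ∈ 𝔞) (y : Fin n → R ⧸ 𝔞) : x • y = 0 := by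
  funext j
  obtain ⟨z, hz⟩ := Ideal.Quotient.mk_surjective (y j)
  rw [Pi.smul_apply, ← hz, ← Ideal.Quotient.mk_eq_mk, ← Submodule.Quotient.mk_smul]
  exact (Submodule.Quotient.mk_eq_zero 𝔞).2 (𝔞.mul_mem_right z hx)

variable [IsNoetherianRing R]

lemma mem_ext_of_smul_eq_zero
    (h : ∀ i, 𝒮.mem (Ext (ModuleCat.of R (R ⧸ 𝔞)) (ModuleCat.of R M) i)) (i : ℕ)
    (N : Type u) [AddCommGroup N] [Module R N] [Module.Finite R N]
    (hN : ∀ x ∈ 𝔞, ∀ y : N, x • y = 0) :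
    𝒮.mem (Ext (ModuleCat.of R N) (ModuleCat.of R M) i) := by
  induction i generalizing N with
  | zero =>
    obtain ⟨n, f, hf⟩ := exists_surjective_pi_quotient 𝔞 N hN
    rw [mem_ext_zero_iff]
    refine 𝒮.mem_of_injective_s9 (LinearMap.lcomp R M f) (fun φ ψ hφ => ?_)
      ((mem_ext_zero_iff 𝒮 M (Fin n → R ⧸ 𝔞)).1 ((closedUnderExtensions_ext 𝒮 M 0).pi
        (mem_ext_punit 𝒮 M (h 0) 0) (R ⧸ 𝔞) (h 0) n))
    exact (LinearMap.cancel_right hf).1 hφ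
  | succ i ih =>
    obtain ⟨n, f, hf⟩ := exists_surjective_pi_quotient 𝔞 N hN
    refine mem_ext_X₃ 𝒮 M (LinearMap.ker f).injective_subtype (LinearMap.exact_subtype_ker_map f) hf
      i (ih _
        fun x hx y => Subtype.ext (smul_pi_quotient_eq_zero hx y.1))
      ((closedUnderExtensions_ext 𝒮 M (i + 1)).pi (mem_ext_punit 𝒮 M (h 0) _) (R ⧸ 𝔞) (h _) n)

lemma mem_tor_of_smul_eq_zero (i : ℕ) (h : ∀ j ≤ i, 𝒮.mem (torModule R (R ⧸ 𝔞) M j))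
    (N : Type u) [AddCommGroup N] [Module R N] [Module.Finite R N]
    (hN : ∀ x ∈ 𝔞, ∀ y : N, x • y = 0) : 𝒮.mem (torModule R N M i) := by
  induction i generalizing N with
  | zero =>
    obtain ⟨n, f, hf⟩ := exists_surjective_pi_quotient 𝔞 N hN
    rw [mem_tor_zero_iff]
    exact 𝒮.mem_of_surjective_s9 (f.rTensor M) (LinearMap.rTensor_surjective M hf)
      ((mem_tor_zero_iff 𝒮 M (Fin n → R ⧸ 𝔞)).1 ((closedUnderExtensions_tor 𝒮 M 0).pi
        (mem_tor_punit 𝒮 M (h 0 le_rfl) 0) (R ⧸ 𝔞) (h 0 le_rfl) n))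
  | succ i ih =>
    obtain ⟨n, f, hf⟩ := exists_surjective_pi_quotient 𝔞 N hN
    refine mem_tor_X₃ 𝒮 M (LinearMap.ker f).injective_subtype (LinearMap.exact_subtype_ker_map f) hf
      i (ih (fun j hj => h j (hj.trans i.le_succ)) _
        fun x hx y => Subtype.ext (smul_pi_quotient_eq_zero hx y.1))
      ((closedUnderExtensions_tor 𝒮 M (i + 1)).pi (mem_tor_punit 𝒮 M (h 0 (Nat.zero_le _)) _)
        (R ⧸ 𝔞) (h _ le_rfl) n)

end DevissageExtTor

section KoszulComplex

variable {R : Type*} [CommRing R]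

/-- A finite free complex, encoded by a square matrix whose nonzero entries lower the degree by
one, on which multiplication by each element of `S` is null-homotopic. -/
structure IsNullHomotopicComplex {ι : Type*} [Fintype ι] [DecidableEq ι] (S : Set R)
    (deg : ι → ℤ) (D : Matrix ι ι R) : Prop where
  deg_eq : ∀ a b, D a b ≠ 0 → deg b = deg a + 1
  mul_self : D * D = 0
  exists_homotopy : ∀ x ∈ S, ∃ h : Matrix ι ι R, D * h + h * D = x • 1

namespace IsNullHomotopicComplex

variable {ι : Type*} [Fintype ι] [DecidableEq ι] {S : Set R} {deg : ι → ℤ} {D : Matrix ι ι R}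

lemma span (hD : IsNullHomotopicComplex S deg D) :
    IsNullHomotopicComplex (Ideal.span S : Set R) deg D where
  deg_eq := hD.deg_eq
  mul_self := hD.mul_self
  exists_homotopy x hx := by
    induction hx using Submodule.span_induction with
    | mem x hx => exact hD.exists_homotopy x hx
    | zero => exact ⟨0, by simp⟩
    | add x y _ _ hx hy =>
      obtain ⟨h, hh⟩ := hx
      obtain ⟨k, hk⟩ := hy
      refine ⟨h + k, ?_⟩
      rw [add_smul, ← hh, ← hk, Matrix.mul_add, Matrix.add_mul]
      abel
    | smul r x _ hx =>
      obtain ⟨h, hh⟩ := hx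
      exact ⟨r • h, by rw [Matrix.mul_smul, Matrix.smul_mul, ← smul_add, hh, smul_smul, smul_eq_mul]⟩

lemma transpose (hD : IsNullHomotopicComplex S deg D) (n : ℤ) :
    IsNullHomotopicComplex S (fun a => n - deg a) D.transpose where
  deg_eq a b h := by have := hD.deg_eq b a h; lia
  mul_self := by rw [← Matrix.transpose_mul, hD.mul_self, Matrix.transpose_zero]
  exists_homotopy x hx := by
    obtain ⟨h, hh⟩ := hD.exists_homotopy x hx
    refine ⟨h.transpose, ?_⟩
    rw [← Matrix.transpose_mul, ← Matrix.transpose_mul, ← Matrix.transpose_add, add_comm, hh,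
      Matrix.transpose_smul, Matrix.transpose_one]

lemma cone (hD : IsNullHomotopicComplex S deg D) (x : R) :
    IsNullHomotopicComplex (insert x S) (Sum.elim deg fun a => deg a + 1)
      (Matrix.fromBlocks D (x • 1) 0 (-D)) where
  deg_eq := by
    rintro (a | a) (b | b) h
    · exact hD.deg_eq a b h
    · obtain rfl : a = b := by
        by_contra hab
        simp [hab] at h
      rfl
    · simp at h
    · have := hD.deg_eq a b (by simpa using h)
      simpa using this
  mul_self := by simp [Matrix.fromBlocks_multiply, hD.mul_self]
  exists_homotopy := by
    rintro y (rfl | hy)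
    · refine ⟨Matrix.fromBlocks 0 0 1 0, ?_⟩
      simp [Matrix.fromBlocks_multiply, Matrix.fromBlocks_add, ← Matrix.fromBlocks_one,
        Matrix.fromBlocks_smul]
    · obtain ⟨h, hh⟩ := hD.exists_homotopy y hy
      refine ⟨Matrix.fromBlocks h 0 0 (-h), ?_⟩
      simp [Matrix.fromBlocks_multiply, Matrix.fromBlocks_add, ← Matrix.fromBlocks_one,
        Matrix.fromBlocks_smul, hh]

end IsNullHomotopicComplex

/-- Existence of the Koszul complex on a finite set of elements. -/
lemma exists_isNullHomotopicComplex (s : Finset R) :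
    ∃ (ι : Type) (_ : Fintype ι) (_ : DecidableEq ι) (deg : ι → ℤ) (D : Matrix ι ι R) (n : ℤ)
      (e : ι), IsNullHomotopicComplex (s : Set R) deg D ∧ (∀ a, 0 ≤ deg a) ∧ (∀ a, deg a ≤ n) ∧
        (∀ a, deg a = 0 ↔ a = e) ∧ ∀ b, D e b ∈ Ideal.span (s : Set R) := by
  classical
  induction s using Finset.induction_on with
  | empty =>
    exact ⟨Unit, inferInstance, inferInstance, 0, 0, 0, (), ⟨by simp, by simp, by simp⟩, by simp,
      by simp, by simp, by simp⟩
  | insert x s _ ih =>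
    obtain ⟨ι, _, _, deg, D, n, e, hD, h0, hn, he, hDe⟩ := ih
    refine ⟨ι ⊕ ι, inferInstance, inferInstance, _, _, n + 1, Sum.inl e,
      (Finset.coe_insert x s).symm ▸ hD.cone x, ?_, ?_, ?_, ?_⟩
    · rintro (a | a)
      · exact h0 a
      · exact (h0 a).trans (by simp)
    · rintro (a | a)
      · exact (hn a).trans (by simp)
      · simpa using hn a
    · rintro (a | a)
      · simpa using he a
      · simpa using (Int.lt_add_one_of_le (h0 a)).ne'
    · rw [Finset.coe_insert]
      rintro (b | b)
      · exact Ideal.span_mono (Set.subset_insert x s) (hDe b)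
      · simpa using Ideal.mul_mem_right _ _ (Ideal.subset_span (Set.mem_insert x s))

end KoszulComplex

section MatrixAction

variable {R : Type*} [CommRing R] {ι : Type*}

open Classical in
/-- Extension by zero of a vector indexed by a subtype. -/
noncomputable def extendSubtype (R : Type*) [CommRing R] {ι : Type*} (q : ι → Prop)
    (M : Type*) [AddCommGroup M] [Module R M] : ({b // q b} → M) →ₗ[R] (ι → M) where
  toFun v b := if h : q b then v ⟨b, h⟩ else 0
  map_add' v w := by ext b; by_cases h : q b <;> simp [h]
  map_smul' r v := by ext b; by_cases h : q b <;> simp [h]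

variable {M : Type*} [AddCommGroup M] [Module R M]

lemma extendSubtype_apply (q : ι → Prop) (v : {b // q b} → M) (b : {b // q b}) :
    extendSubtype R q M v b = v b := by
  simp [extendSubtype, b.2]

lemma extendSubtype_apply_of_not {q : ι → Prop} (v : {b // q b} → M) {b : ι} (hb : ¬ q b) :
    extendSubtype R q M v b = 0 := by
  simp [extendSubtype, hb]

variable [Fintype ι]

/-- The action of a square matrix over `R` on vectors with entries in an `R`-module. -/
def matrixAction (D : Matrix ι ι R) (M : Type*) [AddCommGroup M]
    [Module R M] : (ι → M) →ₗ[R] (ι → M) where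
  toFun v a := ∑ b, D a b • v b
  map_add' v w := by ext; simp [Finset.sum_add_distrib]
  map_smul' r v := by ext; simp [Finset.smul_sum, smul_comm r]

/-- The block of the action of a matrix with rows in `p` and columns in `q`. -/
noncomputable def matrixBlock (D : Matrix ι ι R) (p q : ι → Prop) (M : Type*) [AddCommGroup M]
    [Module R M] : ({b // q b} → M) →ₗ[R] ({a // p a} → M) :=
  LinearMap.funLeft R M Subtype.val ∘ₗ matrixAction D M ∘ₗ extendSubtype R q M

variable {deg : ι → ℤ} {D : Matrix ι ι R}

lemma matrixAction_mul (D D' : Matrix ι ι R) (v : ι → M) :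
    matrixAction (D * D') M v = matrixAction D M (matrixAction D' M v) := by
  ext a
  simp only [matrixAction, LinearMap.coe_mk, AddHom.coe_mk, Matrix.mul_apply, Finset.sum_smul,
    Finset.smul_sum, smul_smul]
  exact Finset.sum_comm

lemma matrixBlock_apply (D : Matrix ι ι R) (p q : ι → Prop) (v : {b // q b} → M) (a : {a // p a}) :
    matrixBlock D p q M v a = matrixAction D M (extendSubtype R q M v) a :=
  rfl

lemma extendSubtype_matrixBlock (hdeg : ∀ a b, D a b ≠ 0 → deg b = deg a + 1) (j : ℤ)
    (v : {b // deg b = j + 1} → M) :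
    extendSubtype R (deg · = j) M (matrixBlock D (deg · = j) (deg · = j + 1) M v) =
      matrixAction D M (extendSubtype R (deg · = j + 1) M v) := by
  ext a
  by_cases ha : deg a = j
  · exact extendSubtype_apply (R := R) (deg · = j) _ ⟨a, ha⟩
  · rw [extendSubtype_apply_of_not (q := (deg · = j)) _ ha]
    refine (Finset.sum_eq_zero fun b _ => ?_).symm
    by_cases hb : deg b = j + 1
    · have : D a b = 0 := by
        by_contra h
        have := hdeg a b h
        lia
      rw [this, zero_smul]
    · rw [extendSubtype_apply_of_not (q := (deg · = j + 1)) _ hb, smul_zero]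

lemma matrixBlock_restrict (hdeg : ∀ a b, D a b ≠ 0 → deg b = deg a + 1) (j : ℤ) (w : ι → M) :
    matrixBlock D (deg · = j) (deg · = j + 1) M (w ∘ Subtype.val) =
      matrixAction D M w ∘ Subtype.val := by
  ext a
  refine Finset.sum_congr rfl fun b _ => ?_
  by_cases hb : deg b = j + 1
  · exact congrArg _ (extendSubtype_apply (R := R) (deg · = j + 1) (w ∘ Subtype.val) ⟨b, hb⟩)
  · have : D a b = 0 := by
      by_contra h
      have := hdeg a b h
      have := a.2
      lia
    rw [this, zero_smul, zero_smul]

lemma IsNullHomotopicComplex.matrixBlock_matrixBlock [DecidableEq ι] {S : Set R}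
    (hD : IsNullHomotopicComplex S deg D) (j : ℤ) (v : {b // deg b = j + 1 + 1} → M) :
    matrixBlock D (deg · = j) (deg · = j + 1) M
      (matrixBlock D (deg · = j + 1) (deg · = j + 1 + 1) M v) = 0 := by
  ext a
  rw [matrixBlock_apply, extendSubtype_matrixBlock hD.deg_eq, ← matrixAction_mul, hD.mul_self]
  simp [matrixAction]

lemma IsNullHomotopicComplex.exists_matrixBlock_eq_smul [DecidableEq ι] {S : Set R}
    (hD : IsNullHomotopicComplex S deg D) (j : ℤ) {x : R} (hx : x ∈ S)
    (v : {b // deg b = j + 1} → M)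
    (hv : matrixBlock D (deg · = j) (deg · = j + 1) M v = 0) :
    ∃ w, matrixBlock D (deg · = j + 1) (deg · = j + 1 + 1) M w = x • v := by
  obtain ⟨h, hh⟩ := hD.exists_homotopy x hx
  refine ⟨matrixAction h M (extendSubtype R _ M v) ∘ Subtype.val, ?_⟩
  have h0 : matrixAction D M (extendSubtype R (deg · = j + 1) M v) = 0 := by
    rw [← extendSubtype_matrixBlock hD.deg_eq, hv, map_zero]
  have h1 : matrixAction (D * h + h * D) M (extendSubtype R (deg · = j + 1) M v) =
      matrixAction D M (matrixAction h M (extendSubtype R (deg · = j + 1) M v)) := by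
    rw [← add_zero (matrixAction D M _), ← map_zero (matrixAction h M), ← h0, ← matrixAction_mul,
      ← matrixAction_mul]
    ext a
    simp [matrixAction, add_smul, Finset.sum_add_distrib]
  rw [matrixBlock_restrict hD.deg_eq, ← h1, hh]
  ext a
  simp [matrixAction, Matrix.one_apply, extendSubtype_apply]

end MatrixAction

section Homology

variable {R : Type u} [CommRing R] {A B C : Type u} [AddCommGroup A] [Module R A]
  [AddCommGroup B] [Module R B] [AddCommGroup C] [Module R C]

/-- The homology of `A → B → C` at `B`. -/
abbrev HomologyQuotient (f : A →ₗ[R] B) (g : B →ₗ[R] C) : Type u :=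
  LinearMap.ker g ⧸ (LinearMap.range f).comap (LinearMap.ker g).subtype

variable (𝒮 : SerreClass R) {f : A →ₗ[R] B} {g : B →ₗ[R] C}

lemma SerreClass.mem_of_homologyQuotient (h : 𝒮.mem (HomologyQuotient f g)) {X : Type u}
    [AddCommGroup X] [Module R X] (φ : LinearMap.ker g →ₗ[R] X) (hφ : Function.Surjective φ)
    (hf : ∀ a (ha : f a ∈ LinearMap.ker g), φ ⟨f a, ha⟩ = 0) : 𝒮.mem X := by
  refine 𝒮.mem_of_surjective_s9 (Submodule.liftQ _ φ ?_) ?_ h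
  · rintro ⟨_, hx⟩ ⟨a, rfl⟩
    exact hf a hx
  · exact fun x => (hφ x).imp' (Submodule.mkQ _) fun y hy => hy

lemma SerreClass.mem_homologyQuotient_congr {A' B' C' : Type u} [AddCommGroup A'] [Module R A']
    [AddCommGroup B'] [Module R B'] [AddCommGroup C'] [Module R C'] {f' : A' →ₗ[R] B'}
    {g' : B' →ₗ[R] C'} (eA : A ≃ₗ[R] A') (eB : B ≃ₗ[R] B') (eC : C ≃ₗ[R] C')
    (hf : ∀ a, eB (f a) = f' (eA a)) (hg : ∀ b, eC (g b) = g' (eB b))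
    (h : 𝒮.mem (HomologyQuotient f g)) : 𝒮.mem (HomologyQuotient f' g') := by
  let e : LinearMap.ker g →ₗ[R] LinearMap.ker g' :=
    (eB.toLinearMap ∘ₗ (LinearMap.ker g).subtype).codRestrict _ fun x => by
      change g' (eB x) = 0
      rw [← hg, show g x = 0 from x.2, map_zero]
  refine 𝒮.mem_of_homologyQuotient h (Submodule.mkQ _ ∘ₗ e) ?_ ?_
  · refine (Submodule.mkQ_surjective _).comp fun y => ⟨⟨eB.symm y, ?_⟩, Subtype.ext (by simp [e])⟩
    rw [LinearMap.mem_ker, ← eC.map_eq_zero_iff, hg, eB.apply_symm_apply]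
    exact y.2
  · exact fun a ha => (Submodule.Quotient.mk_eq_zero _).2 ⟨eA a, (hf a).symm⟩

lemma homologyQuotient_sequence (hfg : ∀ a, g (f a) = 0) :
    ∃ (φ : HomologyQuotient f g →ₗ[R] B ⧸ LinearMap.range f)
      (ψ : (B ⧸ LinearMap.range f) →ₗ[R] LinearMap.range g),
      Function.Injective φ ∧ Function.Exact φ ψ ∧ Function.Surjective ψ := by
  refine ⟨Submodule.mapQ _ _ (LinearMap.ker g).subtype le_rfl,
    Submodule.liftQ _ g.rangeRestrict ?_, ?_, ?_, ?_⟩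
  · rintro _ ⟨a, rfl⟩
    exact Subtype.ext (hfg a)
  · rw [← LinearMap.ker_eq_bot, Submodule.ker_mapQ]
    exact Submodule.mkQ_map_self _
  · intro x
    obtain ⟨x, rfl⟩ := Submodule.mkQ_surjective _ x
    constructor
    · intro hx
      exact ⟨Submodule.Quotient.mk ⟨x, congrArg Subtype.val hx⟩, rfl⟩
    · rintro ⟨y, hy⟩
      obtain ⟨y, rfl⟩ := Submodule.mkQ_surjective _ y
      rw [← hy]
      exact Subtype.ext y.2
  · exact fun x => (g.surjective_rangeRestrict x).imp' (Submodule.mkQ _) fun y hy => hy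

lemma smul_homologyQuotient_eq_zero {x : R} (hx : ∀ v, g v = 0 → ∃ w, f w = x • v)
    (y : HomologyQuotient f g) : x • y = 0 := by
  obtain ⟨y, rfl⟩ := Submodule.mkQ_surjective _ y
  exact (Submodule.Quotient.mk_eq_zero _).2 (hx y y.2)

end Homology

section ExtCohomology

open CategoryTheory.Abelian

variable {R : Type u} [CommRing R] [IsNoetherianRing R] (𝒮 : SerreClass R) {𝔞 : Ideal R}
  (M : Type u) [AddCommGroup M] [Module R M]
  {K : ℤ → Type u} [∀ j, AddCommGroup (K j)] [∀ j, Module R (K j)] [∀ j, Module.Finite R (K j)]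
  [∀ j, Module.Projective R (K j)] {d : ∀ j, K (j + 1) →ₗ[R] K j}

lemma mem_ext_cokernel (h : ∀ i, 𝒮.mem (Ext (ModuleCat.of R (R ⧸ 𝔞)) (ModuleCat.of R M) i))
    (hd : ∀ j v, d j (d (j + 1) v) = 0) (h0 : ∀ j < 0, Subsingleton (K j))
    (hx : ∀ x ∈ 𝔞, ∀ j v, d j v = 0 → ∃ w, d (j + 1) w = x • v) (j : ℤ) (i : ℕ) :
    𝒮.mem (Ext (ModuleCat.of R (K j ⧸ LinearMap.range (d j))) (ModuleCat.of R M) (i + 1)) := by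
  obtain ⟨n, hn⟩ : ∃ n : ℕ, j < n := ⟨(j + 1).toNat, by lia⟩
  induction n generalizing i j with
  | zero =>
    have := h0 j hn
    have : Subsingleton (K j ⧸ LinearMap.range (d j)) := (Submodule.mkQ_surjective _).subsingleton
    exact mem_ext_of_projective 𝒮 M _ i (h 0)
  | succ n ih =>
    obtain ⟨k, rfl⟩ : ∃ k, j = k + 1 := ⟨j - 1, by lia⟩
    obtain ⟨φ, ψ, hφ, hφψ, hψ⟩ := homologyQuotient_sequence (hd k)
    refine mem_ext_X₂ 𝒮 M hφ hφψ hψ (i + 1) ?_ ?_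
    · exact mem_ext_of_smul_eq_zero 𝒮 M h (i + 1) _
        fun x hx' => smul_homologyQuotient_eq_zero (hx x hx' k)
    · exact mem_ext_X₁ 𝒮 M (Submodule.injective_subtype _)
        (LinearMap.exact_subtype_mkQ (LinearMap.range (d k))) (Submodule.mkQ_surjective _) (i + 1)
        (mem_ext_of_projective 𝒮 M _ i (h 0)) (ih k (i + 1) (by lia))

lemma mem_homologyQuotient_lcomp
    (h : ∀ i, 𝒮.mem (Ext (ModuleCat.of R (R ⧸ 𝔞)) (ModuleCat.of R M) i))
    (hd : ∀ j v, d j (d (j + 1) v) = 0) (h0 : ∀ j < 0, Subsingleton (K j))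
    (hx : ∀ x ∈ 𝔞, ∀ j v, d j v = 0 → ∃ w, d (j + 1) w = x • v) (j : ℤ) :
    𝒮.mem (HomologyQuotient (LinearMap.lcomp R M (d j)) (LinearMap.lcomp R M (d (j + 1)))) := by
  obtain ⟨δ, hδ⟩ := exists_hom_to_ext_one_exact M (Submodule.injective_subtype _)
    (LinearMap.exact_subtype_mkQ (LinearMap.range (d j))) (Submodule.mkQ_surjective _)
  let π : LinearMap.ker (d j) →ₗ[R] HomologyQuotient (d (j + 1)) (d j) := Submodule.mkQ _
  let P := (LinearMap.range (LinearMap.lcomp R M (d j))).comap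
    (LinearMap.ker (LinearMap.lcomp R M (d (j + 1)))).subtype
  let τ : (LinearMap.range (d j) →ₗ[R] M) →ₗ[R] LinearMap.ker (LinearMap.lcomp R M (d (j + 1))) :=
    (LinearMap.lcomp R M (d j).rangeRestrict).codRestrict _ fun φ => by
      ext v
      have : (d j).rangeRestrict (d (j + 1) v) = 0 := Subtype.ext (hd j v)
      simp [this]
  have hτ : LinearMap.ker δ ≤ LinearMap.ker (P.mkQ ∘ₗ τ) := fun φ hφ => by
    obtain ⟨ψ, rfl⟩ := hδ φ hφ
    exact (Submodule.Quotient.mk_eq_zero P).2 ⟨ψ, rfl⟩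
  let σ : LinearMap.ker (LinearMap.lcomp R M (d (j + 1))) →ₗ[R]
      LinearMap.range (LinearMap.lcomp R M π) :=
    (LinearMap.lcomp R M (LinearMap.ker (d j)).subtype ∘ₗ Submodule.subtype _).codRestrict _
      fun φ => by
        refine ⟨Submodule.liftQ _ (φ.1 ∘ₗ (LinearMap.ker (d j)).subtype) ?_,
          LinearMap.ext fun x => rfl⟩
        rintro x ⟨w, hw⟩
        have hw : d (j + 1) w = x.1 := hw
        change φ.1 x.1 = 0
        rw [← hw]
        exact LinearMap.congr_fun φ.2 w
  have hσ : P ≤ LinearMap.ker σ := by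
    rintro φ ⟨ψ, hψ⟩
    ext x
    have : φ.1 x.1 = ψ (d j x.1) := (LinearMap.congr_fun hψ x.1).symm
    rwa [show d j x.1 = 0 from x.2, map_zero] at this
  refine 𝒮.mem_of_exact ((LinearMap.ker δ).liftQ (P.mkQ ∘ₗ τ) hτ) (P.liftQ σ hσ) ?_
    (𝒮.mem_of_injective_s9 ((LinearMap.ker δ).liftQ δ le_rfl) ?_
      (mem_ext_cokernel 𝒮 M h hd h0 hx j 0)) (𝒮.mem_of_surjective_s9
        (LinearMap.lcomp R M π).rangeRestrict (LinearMap.surjective_rangeRestrict _)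
        ((mem_ext_zero_iff 𝒮 M _).1 (mem_ext_of_smul_eq_zero 𝒮 M h 0 _
          fun x hx' => smul_homologyQuotient_eq_zero (hx x hx' j))))
  · intro y
    obtain ⟨φ, rfl⟩ := P.mkQ_surjective y
    constructor
    · intro hφ
      have hφ' : ∀ x, d j x = 0 → φ.1 x = 0 := fun x hx =>
        LinearMap.congr_fun (congrArg Subtype.val hφ) ⟨x, hx⟩
      have hker : LinearMap.ker (d j).rangeRestrict ≤ LinearMap.ker φ.1 := fun x hx =>
        hφ' x (congrArg Subtype.val hx)
      let e := (d j).rangeRestrict.quotKerEquivOfSurjective (LinearMap.surjective_rangeRestrict _)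
      refine ⟨Submodule.Quotient.mk (Submodule.liftQ _ φ.1 hker ∘ₗ e.symm.toLinearMap), ?_⟩
      refine congrArg P.mkQ (Subtype.ext (LinearMap.ext fun x => ?_))
      have : e.symm ((d j).rangeRestrict x) = Submodule.Quotient.mk x :=
        (LinearEquiv.symm_apply_eq e).2 rfl
      change Submodule.liftQ _ φ.1 hker (e.symm ((d j).rangeRestrict x)) = φ.1 x
      rw [this]
      rfl
    · rintro ⟨z, hz⟩
      obtain ⟨ψ, rfl⟩ := Submodule.mkQ_surjective _ z
      rw [← hz]
      refine Subtype.ext (LinearMap.ext fun x => ?_)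
      have : (d j).rangeRestrict x.1 = 0 := Subtype.ext x.2
      change ψ ((d j).rangeRestrict x.1) = 0
      rw [this, map_zero]
  · rw [← LinearMap.ker_eq_bot, Submodule.ker_liftQ]
    exact Submodule.mkQ_map_self _

end ExtCohomology

section TorHomology

open TensorProduct

variable {R : Type u} [CommRing R] (𝒮 : SerreClass R) {𝔞 : Ideal R}
  (M : Type u) [AddCommGroup M] [Module R M]

lemma mem_tor_of_linearEquiv {A B : Type u} [AddCommGroup A] [Module R A] [AddCommGroup B]
    [Module R B] (e : A ≃ₗ[R] B) (i : ℕ) (h : 𝒮.mem (torModule R A M i)) :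
    𝒮.mem (torModule R B M i) :=
  mem_tor_X₂ 𝒮 M (f := e.toLinearMap) (g := (0 : B →ₗ[R] PUnit.{u + 1})) e.injective
    (fun x => ⟨fun _ => e.surjective x, fun _ => rfl⟩) (Function.surjective_to_subsingleton _) i h
    (mem_tor_punit 𝒮 M h i)

variable {K : ℤ → Type u} [∀ j, AddCommGroup (K j)] [∀ j, Module R (K j)]
  [∀ j, Module.Flat R (K j)] {d : ∀ j, K (j + 1) →ₗ[R] K j}

lemma mem_tor_one_cokernel (hd : ∀ j v, d j (d (j + 1) v) = 0)
    (h : ∀ j, 𝒮.mem (HomologyQuotient ((d (j + 1)).rTensor M) ((d j).rTensor M))) (j : ℤ) :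
    𝒮.mem (torModule R (K j ⧸ LinearMap.range (d j)) M 1) := by
  refine mem_tor_one_of_mem_ker_rTensor 𝒮 M (Submodule.injective_subtype _)
    (LinearMap.exact_subtype_mkQ (LinearMap.range (d j))) (Submodule.mkQ_surjective _) ?_
  have hcomp (t) : (LinearMap.range (d j)).subtype.rTensor M ((d j).rangeRestrict.rTensor M t) =
      (d j).rTensor M t := by
    rw [← LinearMap.comp_apply, ← LinearMap.rTensor_comp]
    rfl
  let φ : LinearMap.ker ((d j).rTensor M) →ₗ[R]
      LinearMap.ker ((LinearMap.range (d j)).subtype.rTensor M) :=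
    ((d j).rangeRestrict.rTensor M ∘ₗ Submodule.subtype _).codRestrict _ fun t =>
      (hcomp t.1).trans t.2
  refine 𝒮.mem_of_homologyQuotient (h j) φ ?_ ?_
  · rintro ⟨y, hy⟩
    obtain ⟨t, rfl⟩ := LinearMap.rTensor_surjective M (LinearMap.surjective_rangeRestrict (d j)) y
    exact ⟨⟨t, (hcomp t).symm.trans hy⟩, rfl⟩
  · intro t ht
    refine Subtype.ext ?_
    change (d j).rangeRestrict.rTensor M ((d (j + 1)).rTensor M t) = 0
    rw [← LinearMap.comp_apply, ← LinearMap.rTensor_comp]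
    have : (d j).rangeRestrict ∘ₗ d (j + 1) = 0 :=
      LinearMap.ext fun v => Subtype.ext (hd j v)
    rw [this, LinearMap.rTensor_zero, LinearMap.zero_apply]

lemma mem_tor_of_mem_homologyQuotient [IsNoetherianRing R] [∀ j, Module.Finite R (K j)]
    (hd : ∀ j v, d j (d (j + 1) v) = 0)
    (hx : ∀ x ∈ 𝔞, ∀ j v, d j v = 0 → ∃ w, d (j + 1) w = x • v)
    (h : ∀ j, 𝒮.mem (HomologyQuotient ((d (j + 1)).rTensor M) ((d j).rTensor M)))
    (h0 : 𝒮.mem ((R ⧸ 𝔞) ⊗[R] M)) {j₀ : ℤ}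
    (e : (K j₀ ⧸ LinearMap.range (d j₀)) ≃ₗ[R] R ⧸ 𝔞) (i : ℕ) :
    𝒮.mem (torModule R (R ⧸ 𝔞) M i) := by
  suffices H : ∀ m, (∀ i ≤ m, 𝒮.mem (torModule R (R ⧸ 𝔞) M i)) ∧
      ∀ j, 𝒮.mem (torModule R (K j ⧸ LinearMap.range (d j)) M (m + 1)) from (H i).1 i le_rfl
  intro m
  induction m with
  | zero =>
    refine ⟨fun i hi => ?_, mem_tor_one_cokernel 𝒮 M hd h⟩
    obtain rfl : i = 0 := by lia
    exact (mem_tor_zero_iff 𝒮 M _).2 h0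
  | succ m ih =>
    refine ⟨fun i hi => ?_, fun j => ?_⟩
    · rcases Nat.le_succ_iff.1 hi with hi | rfl
      · exact ih.1 i hi
      · exact mem_tor_of_linearEquiv 𝒮 M e _ (ih.2 j₀)
    · obtain ⟨φ, ψ, hφ, hφψ, hψ⟩ := homologyQuotient_sequence (hd j)
      have := subsingleton_tor_of_flat (R := R) M (K j) (m + 1)
      exact mem_tor_X₃ 𝒮 M (Submodule.injective_subtype _)
        (LinearMap.exact_subtype_mkQ (LinearMap.range (d j))) (Submodule.mkQ_surjective _) (m + 1)
        (mem_tor_X₃ 𝒮 M hφ hφψ hψ m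
          (mem_tor_of_smul_eq_zero 𝒮 M m ih.1 _
            fun x hx' => smul_homologyQuotient_eq_zero (hx x hx' j))
          (ih.2 (j + 1)))
        (𝒮.mem_of_subsingleton h0)

end TorHomology

section Comparison

open CategoryTheory.Abelian TensorProduct

variable {R : Type u} [CommRing R] {ι : Type} [Fintype ι]

section Blocks

variable {M : Type u} [AddCommGroup M] [Module R M] (D : Matrix ι ι R) (p q : ι → Prop)

lemma matrixBlock_apply_eq_sum [Fintype {b // q b}] (v : {b // q b} → M) (a : {a // p a}) :
    matrixBlock D p q M v a = ∑ b : {b // q b}, D a b • v b := by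
  refine (Fintype.sum_of_injective Subtype.val Subtype.val_injective _ _ (fun b hb => ?_)
    fun b => ?_).symm
  · rw [extendSubtype_apply_of_not (q := q) v (fun h => hb ⟨⟨b, h⟩, rfl⟩), smul_zero]
  · rw [extendSubtype_apply]

lemma piRing_lcomp_matrixBlock [Fintype {a // p a}] [DecidableEq {a // p a}]
    [Fintype {b // q b}] [DecidableEq {b // q b}] (φ : ({a // p a} → R) →ₗ[R] M) :
    LinearEquiv.piRing R M {b // q b} R (LinearMap.lcomp R M (matrixBlock D.transpose p q R) φ) =
      matrixBlock D q p M (LinearEquiv.piRing R M {a // p a} R φ) := by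
  ext b
  rw [matrixBlock_apply_eq_sum, LinearEquiv.piRing_apply, LinearMap.lcomp_apply,
    LinearMap.pi_apply_eq_sum_univ φ]
  refine Finset.sum_congr rfl fun a _ => ?_
  rw [matrixBlock_apply_eq_sum, LinearEquiv.piRing_apply]
  congr 2
  · simp [Pi.single_apply]
  · ext i
    simp [Pi.single_apply, eq_comm]

lemma piScalarRight_comm_rTensor_matrixBlock [Fintype {a // p a}] [DecidableEq {a // p a}]
    [Fintype {b // q b}] [DecidableEq {b // q b}] (t : ({b // q b} → R) ⊗[R] M) :
    TensorProduct.piScalarRight R R M {a // p a}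
        (TensorProduct.comm R _ M ((matrixBlock D p q R).rTensor M t)) =
      matrixBlock D p q M (TensorProduct.piScalarRight R R M {b // q b}
        (TensorProduct.comm R _ M t)) := by
  induction t with
  | zero => simp
  | add x y hx hy => simp only [map_add, hx, hy]
  | tmul v m =>
    ext a
    simp [matrixBlock_apply_eq_sum, Finset.sum_smul, smul_smul]

end Blocks

variable {𝔞 : Ideal R} {deg : ι → ℤ} {D : Matrix ι ι R}
  (𝒮 : SerreClass R) (M : Type u) [AddCommGroup M] [Module R M]

lemma mem_homologyQuotient_matrixBlock_congr {p q r p' q' r' : ι → Prop} (hp : ∀ a, p a ↔ p' a)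
    (hq : ∀ a, q a ↔ q' a) (hr : ∀ a, r a ↔ r' a)
    (h : 𝒮.mem (HomologyQuotient (matrixBlock D q r M) (matrixBlock D p q M))) :
    𝒮.mem (HomologyQuotient (matrixBlock D q' r' M) (matrixBlock D p' q' M)) := by
  obtain rfl : p = p' := funext fun a => propext (hp a)
  obtain rfl : q = q' := funext fun a => propext (hq a)
  obtain rfl : r = r' := funext fun a => propext (hr a)
  exact h

namespace IsNullHomotopicComplex

lemma mem_homologyQuotient_matrixBlock [IsNoetherianRing R] [DecidableEq ι]
    (hD : IsNullHomotopicComplex (𝔞 : Set R) deg D) {n : ℤ} (hn : ∀ a, deg a ≤ n)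
    (h : ∀ i, 𝒮.mem (Ext (ModuleCat.of R (R ⧸ 𝔞)) (ModuleCat.of R M) i)) (j : ℤ) :
    𝒮.mem (HomologyQuotient (matrixBlock D (deg · = j + 1) (deg · = j + 1 + 1) M)
      (matrixBlock D (deg · = j) (deg · = j + 1) M)) := by
  classical
  have hD' := hD.transpose n
  refine mem_homologyQuotient_matrixBlock_congr 𝒮 M (p := (n - deg · = n - j - 2 + 1 + 1))
    (q := (n - deg · = n - j - 2 + 1)) (r := (n - deg · = n - j - 2))
    (by lia) (by lia) (by lia) ?_
  refine 𝒮.mem_homologyQuotient_congr (LinearEquiv.piRing R M _ R) (LinearEquiv.piRing R M _ R)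
    (LinearEquiv.piRing R M _ R) (piRing_lcomp_matrixBlock D _ _) (piRing_lcomp_matrixBlock D _ _)
    (mem_homologyQuotient_lcomp 𝒮 M (K := fun j => {a // n - deg a = j} → R)
      (d := fun j => matrixBlock D.transpose (n - deg · = j) (n - deg · = j + 1) R) h
      (fun j v => hD'.matrixBlock_matrixBlock j v) (fun j hj => ?_)
      (fun x hx j v hv => hD'.exists_matrixBlock_eq_smul j hx v hv) (n - j - 2))
  have : IsEmpty {a // n - deg a = j} := ⟨fun a => by have := hn a; have := a.2; lia⟩
  infer_instance

lemma mem_homologyQuotient_rTensor {j : ℤ}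
    (h : 𝒮.mem (HomologyQuotient (matrixBlock D (deg · = j + 1) (deg · = j + 1 + 1) M)
      (matrixBlock D (deg · = j) (deg · = j + 1) M))) :
    𝒮.mem (HomologyQuotient ((matrixBlock D (deg · = j + 1) (deg · = j + 1 + 1) R).rTensor M)
      ((matrixBlock D (deg · = j) (deg · = j + 1) R).rTensor M)) := by
  classical
  let e (p : ι → Prop) : (({a // p a} → R) ⊗[R] M) ≃ₗ[R] ({a // p a} → M) :=
    (TensorProduct.comm R _ M).trans (TensorProduct.piScalarRight R R M {a // p a})
  have he (p q : ι → Prop) (v) : (e p).symm (matrixBlock D p q M v) =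
      (matrixBlock D p q R).rTensor M ((e q).symm v) := by
    rw [LinearEquiv.symm_apply_eq]
    exact .trans (by simp [e]) (piScalarRight_comm_rTensor_matrixBlock D p q _).symm
  exact 𝒮.mem_homologyQuotient_congr (e _).symm (e _).symm (e _).symm (he _ _) (he _ _) h

lemma mem_quotient_tensorProduct (hpos : ∀ a, 0 ≤ deg a) {e : {a // deg a = -1 + 1}}
    (hDe : ∀ b, D e b ∈ 𝔞)
    (h : 𝒮.mem (HomologyQuotient (matrixBlock D (deg · = -1 + 1) (deg · = -1 + 1 + 1) M)
      (matrixBlock D (deg · = -1) (deg · = -1 + 1) M))) :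
    𝒮.mem ((R ⧸ 𝔞) ⊗[R] M) := by
  have : IsEmpty {a // deg a = -1} := ⟨fun a => by have := hpos a; have := a.2; lia⟩
  have hmk (r : R) (m : M) : (Submodule.Quotient.mk r : R ⧸ 𝔞) ⊗ₜ[R] m =
      (Submodule.Quotient.mk 1 : R ⧸ 𝔞) ⊗ₜ[R] (r • m) := by
    rw [← TensorProduct.smul_tmul, ← Submodule.Quotient.mk_smul, smul_eq_mul, mul_one]
  refine 𝒮.mem_of_homologyQuotient h (TensorProduct.mk R (R ⧸ 𝔞) M (Submodule.Quotient.mk 1) ∘ₗ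
    LinearMap.proj e ∘ₗ Submodule.subtype _) (fun t => ?_) fun v _ => ?_
  · have hsurj (m : M) : ∃ v : LinearMap.ker (matrixBlock D (deg · = -1) (deg · = -1 + 1) M),
        v.1 e = m := ⟨⟨fun _ => m, Subsingleton.elim _ _⟩, rfl⟩
    suffices H : ∃ m, (Submodule.Quotient.mk 1 : R ⧸ 𝔞) ⊗ₜ[R] m = t by
      obtain ⟨m, rfl⟩ := H
      obtain ⟨v, rfl⟩ := hsurj m
      exact ⟨v, rfl⟩
    induction t with
    | zero => exact ⟨0, TensorProduct.tmul_zero _ _⟩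
    | add x y hx hy =>
      obtain ⟨m, rfl⟩ := hx
      obtain ⟨m', rfl⟩ := hy
      exact ⟨m + m', TensorProduct.tmul_add _ _ _⟩
    | tmul r m =>
      obtain ⟨r, rfl⟩ := Submodule.mkQ_surjective _ r
      exact ⟨r • m, (hmk r m).symm⟩
  · change (Submodule.Quotient.mk 1 : R ⧸ 𝔞) ⊗ₜ[R] (∑ b, D e b • _) = 0
    rw [TensorProduct.tmul_sum]
    refine Finset.sum_eq_zero fun b _ => ?_
    rw [← hmk, (Submodule.Quotient.mk_eq_zero 𝔞).2 (hDe b), TensorProduct.zero_tmul]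

lemma nonempty_cokernel_linearEquiv [DecidableEq ι]
    (hD : IsNullHomotopicComplex (𝔞 : Set R) deg D) (hpos : ∀ a, 0 ≤ deg a)
    {e : {a // deg a = -1 + 1}} (he : ∀ a, a = e) (hDe : ∀ b, D e b ∈ 𝔞) :
    Nonempty ((({a // deg a = -1 + 1} → R) ⧸
      LinearMap.range (matrixBlock D (deg · = -1 + 1) (deg · = -1 + 1 + 1) R)) ≃ₗ[R] R ⧸ 𝔞) := by
  have : IsEmpty {a // deg a = -1} := ⟨fun a => by have := hpos a; have := a.2; lia⟩
  let φ : ({a // deg a = -1 + 1} → R) →ₗ[R] R ⧸ 𝔞 := Submodule.mkQ 𝔞 ∘ₗ LinearMap.proj e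
  have hφ : Function.Surjective φ :=
    (Submodule.mkQ_surjective _).comp fun r => ⟨fun _ => r, rfl⟩
  refine ⟨(Submodule.quotEquivOfEq _ (LinearMap.ker φ) ?_).trans
    (φ.quotKerEquivOfSurjective hφ)⟩
  ext v
  constructor
  · rintro ⟨w, rfl⟩
    exact (Submodule.Quotient.mk_eq_zero 𝔞).2 (sum_mem fun b _ => 𝔞.mul_mem_right _ (hDe b))
  · intro hv
    obtain ⟨w, hw⟩ := hD.exists_matrixBlock_eq_smul (-1) ((Submodule.Quotient.mk_eq_zero 𝔞).1 hv)
      (fun _ => (1 : R)) (Subsingleton.elim _ _)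
    refine ⟨w, hw.trans (funext fun a => ?_)⟩
    simp [he a]

end IsNullHomotopicComplex

lemma mem_tor_quotient [IsNoetherianRing R]
    (h : ∀ i, 𝒮.mem (Ext (ModuleCat.of R (R ⧸ 𝔞)) (ModuleCat.of R M) i)) (i : ℕ) :
    𝒮.mem (torModule R (R ⧸ 𝔞) M i) := by
  obtain ⟨s, rfl⟩ := IsNoetherian.noetherian 𝔞
  obtain ⟨ι, _, _, deg, D, n, e, hD, hpos, hn, he, hDe⟩ := exists_isNullHomotopicComplex s
  have hD := hD.span
  have hH := hD.mem_homologyQuotient_matrixBlock 𝒮 M hn h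
  have he' (a : {a // deg a = -1 + 1}) : a = ⟨e, (he e).2 rfl⟩ := Subtype.ext ((he a).1 a.2)
  obtain ⟨E⟩ := hD.nonempty_cokernel_linearEquiv hpos he' hDe
  exact mem_tor_of_mem_homologyQuotient 𝒮 M (K := fun j => {a // deg a = j} → R)
    (d := fun j => matrixBlock D (deg · = j) (deg · = j + 1) R)
    (fun j v => hD.matrixBlock_matrixBlock j v)
    (fun x hx j v hv => hD.exists_matrixBlock_eq_smul j hx v hv)
    (fun j => IsNullHomotopicComplex.mem_homologyQuotient_rTensor 𝒮 M (hH j))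
    (IsNullHomotopicComplex.mem_quotient_tensorProduct 𝒮 M hpos (e := ⟨e, (he e).2 rfl⟩)
      hDe (hH (-1))) E i

end Comparison

/-- Theorem 2.9: if `Ext^i_R(R/𝔞, M) ∈ 𝒮` for all `i`, then for every finite module `N`
supported in `V(𝔞)`, all the modules `Ext^i_R(N, M)` and `Tor_i^R(N, M)` belong to `𝒮`. -/
theorem ext_tor_mem_serre_of_supp_subset
    (R : Type u) [CommRing R] [IsNoetherianRing R] (𝔞 : Ideal R) (𝒮 : SerreClass R)
    (M : Type u) [AddCommGroup M] [Module R M]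
    (hM : ∀ i : ℕ, 𝒮.mem (extModule R (R ⧸ 𝔞) M i))
    (N : Type u) [AddCommGroup N] [Module R N] [Module.Finite R N]
    (hN : Module.support R N ⊆ PrimeSpectrum.zeroLocus (𝔞 : Set R)) :
    ∀ i : ℕ, 𝒮.mem (extModule R N M i) ∧ 𝒮.mem (torModule R N M i) := by
  have hE (i) := (nonempty_extModule_linearEquiv (R := R) (R ⧸ 𝔞) M i).elim
    fun e => 𝒮.mem_of_linearEquiv _ _ e (hM i)
  refine fun i => ⟨?_, ?_⟩
  · obtain ⟨e⟩ := nonempty_extModule_linearEquiv (R := R) N M i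
    exact 𝒮.mem_of_linearEquiv _ _ e.symm ((closedUnderExtensions_ext 𝒮 M i).of_support_subset 𝔞
      (fun N => mem_ext_of_smul_eq_zero 𝒮 M hE i N) N hN)
  · exact (closedUnderExtensions_tor 𝒮 M i).of_support_subset 𝔞
      (fun N => mem_tor_of_smul_eq_zero 𝒮 M i (fun j _ => mem_tor_quotient 𝒮 M hE j) N) N hN
end
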